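/- Let B^{H,K} be a bifractional Brownian motion in ℝ with indices H ∈ (0,1) and K ∈ (0,1], and for ε > 0 and t ∈ [0,1] set Z_ε(t) = (B^{H,K}(t+ε) − B^{H,K}(t)) / ε^{HK}. Let ρ be a centered normal random variable with variance σ² = 2^{1−K}. Then: (i) for every integer k ≥ 1, almost surely ∫₀¹ (Z_ε(t))^k dt → E(ρ^k) as ε → 0⁺; and (ii) for every interval J ⊆ [0,1], almost surely, for every x ∈ ℝ, λ₁{ t ∈ J : Z_ε(t) ≤ x } → λ₁(J) · P(ρ ≤ x) as ε → 0⁺, where λ₁ denotes Lebesgue measure on ℝ. -/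

import Mathlib

open MeasureTheory ProbabilityTheory Filter Topology

/-- The bifractional covariance function. -/
noncomputable def Rbif (H K s t : ℝ) : ℝ :=
  (2 : ℝ) ^ (-K) * ((t ^ (2 * H) + s ^ (2 * H)) ^ K - |t - s| ^ (2 * H * K))

/-- `B` is a bifractional Brownian motion in `ℝ` with indices `H, K` on `(Ω, μ)`. -/
def IsBifBM {Ω : Type*} [MeasurableSpace Ω] (μ : Measure Ω) (H K : ℝ)
    (B : ℝ → Ω → ℝ) : Prop :=
  (∀ᵐ ω ∂μ, ContinuousOn (fun t => B t ω) (Set.Ici 0)) ∧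
  ∀ (n : ℕ) (t : Fin n → ℝ), (∀ i, 0 ≤ t i) → ∀ a : Fin n → ℝ,
    Measure.map (fun ω => ∑ i, a i * B (t i) ω) μ =
      gaussianReal 0 (Real.toNNReal (∑ i, ∑ j, a i * a j * Rbif H K (t i) (t j)))

/-- normalised increment covariance -/
noncomputable def gc (H K ε s t : ℝ) : ℝ :=
  (Rbif H K (s + ε) (t + ε) - Rbif H K (s + ε) t - Rbif H K s (t + ε) + Rbif H K s t)
    / (ε ^ (H * K)) ^ 2

lemma conc4 {K : ℝ} (h0 : 0 ≤ K) (h1 : K ≤ 1) {m p q : ℝ} (hm : 0 ≤ m) (hp : 0 ≤ p)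
    (hq : 0 ≤ q) : (m + p + q) ^ K + m ^ K ≤ (m + p) ^ K + (m + q) ^ K := by
  rcases (add_nonneg hp hq).eq_or_lt with h | h
  · have hp0 : p = 0 := by linarith
    have hq0 : q = 0 := by linarith
    subst hp0 hq0; simp
  have hc := Real.concaveOn_rpow h0 h1
  have e1 := hc.2 (show (m:ℝ) ∈ Set.Ici 0 from hm)
    (show m + p + q ∈ Set.Ici (0:ℝ) from by show (0:ℝ) ≤ _; positivity)
    (show 0 ≤ q / (p + q) by positivity) (show 0 ≤ p / (p + q) by positivity) (by field_simp; ring)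
  have e2 := hc.2 (show (m:ℝ) ∈ Set.Ici 0 from hm)
    (show m + p + q ∈ Set.Ici (0:ℝ) from by show (0:ℝ) ≤ _; positivity)
    (show 0 ≤ p / (p + q) by positivity) (show 0 ≤ q / (p + q) by positivity) (by field_simp)
  simp only [smul_eq_mul] at e1 e2
  have i1 : q / (p + q) * m + p / (p + q) * (m + p + q) = m + p := by field_simp; ring
  have i2 : p / (p + q) * m + q / (p + q) * (m + p + q) = m + q := by field_simp; ring
  rw [i1] at e1
  rw [i2] at e2
  have i3 : q / (p + q) * m ^ K + p / (p + q) * (m + p + q) ^ K +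
    (p / (p + q) * m ^ K + q / (p + q) * (m + p + q) ^ K) = m ^ K + (m + p + q) ^ K := by
    field_simp; ring
  linarith

lemma midconc {K : ℝ} (h0 : 0 ≤ K) (h1 : K ≤ 1) {x y : ℝ} (hx : 0 ≤ x) (hy : 0 ≤ y) :
    x ^ K + y ^ K ≤ (2:ℝ) ^ (1 - K) * (x + y) ^ K := by
  have hc := (Real.concaveOn_rpow h0 h1).2 (show x ∈ Set.Ici (0:ℝ) from hx) (show y ∈ Set.Ici (0:ℝ) from hy)
    (show (0:ℝ) ≤ 1/2 by positivity) (show (0:ℝ) ≤ 1/2 by positivity) (by norm_num)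
  simp only [smul_eq_mul] at hc
  have : (1/2 * x + 1/2*y : ℝ) = (x + y) / 2 := by ring
  rw [this, Real.div_rpow (by positivity) (by norm_num)] at hc
  rw [Real.rpow_sub (by norm_num), Real.rpow_one]
  have h2 : (0:ℝ) < 2 ^ K := by positivity
  have : (2:ℝ) / 2 ^ K * (x + y) ^ K = 2 * ((x+y)^K / 2 ^ K) := by ring
  rw [this]; linarith

lemma convmid {q : ℝ} (h1 : 1 ≤ q) {u e : ℝ} (he : 0 ≤ e) (hu : e ≤ u) :
    2 * u ^ q ≤ (u - e) ^ q + (u + e) ^ q := by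
  have hc := (convexOn_rpow h1).2 (show u - e ∈ Set.Ici (0:ℝ) from by show (0:ℝ) ≤ _; linarith)
    (show u + e ∈ Set.Ici (0:ℝ) from by show (0:ℝ) ≤ _; linarith)
    (show (0:ℝ) ≤ 1/2 by positivity) (show (0:ℝ) ≤ 1/2 by positivity) (by norm_num)
  simp only [smul_eq_mul] at hc
  have : (1/2 * (u-e) + 1/2*(u+e) : ℝ) = u := by ring
  rw [this] at hc; linarith

lemma concmid {q : ℝ} (h0 : 0 ≤ q) (h1 : q ≤ 1) {u e : ℝ} (he : 0 ≤ e) (hu : e ≤ u) :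
    (u - e) ^ q + (u + e) ^ q ≤ 2 * u ^ q := by
  have hc := conc4 h0 h1 (m := u - e) (p := e) (q := e) (by linarith) he he
  have i1 : u - e + e + e = u + e := by ring
  have i2 : u - e + e = u := by ring
  rw [i1, i2] at hc; linarith

/-- sign of the second difference of `|x|^q` away from the diagonal -/
lemma phi_sign {q : ℝ} (h0 : 0 ≤ q) : ∃ η : ℝ, |η| = 1 ∧ ∀ e τ : ℝ, 0 ≤ e → e ≤ |τ| →
    0 ≤ η * (2 * |τ| ^ q - |τ - e| ^ q - |τ + e| ^ q) := by
  have key : ∀ e τ : ℝ, 0 ≤ e → e ≤ |τ| → |τ - e| ^ q + |τ + e| ^ q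
      = (|τ| - e) ^ q + (|τ| + e) ^ q := by
    intro e τ he hτ
    rcases abs_cases τ with ⟨h, h'⟩ | ⟨h, h'⟩
    · rw [h] at hτ ⊢
      rw [abs_of_nonneg (by linarith : 0 ≤ τ - e), abs_of_nonneg (by linarith : 0 ≤ τ + e)]
    · rw [h] at hτ ⊢
      rw [abs_of_nonpos (by linarith : τ - e ≤ 0), abs_of_nonpos (by linarith : τ + e ≤ 0)]
      rw [add_comm]; congr 2 <;> ring
  rcases le_total 1 q with h | h
  · refine ⟨-1, by simp, fun e τ he hτ => ?_⟩
    have := convmid h he hτ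
    have := key e τ he hτ
    linarith
  · refine ⟨1, by simp, fun e τ he hτ => ?_⟩
    have := concmid h0 h he hτ
    have := key e τ he hτ
    linarith

lemma Rbif_diag {H K : ℝ} (hH : 0 < H) (hK : 0 < K) {t : ℝ} (ht : 0 ≤ t) :
    Rbif H K t t = (t ^ (2 * H)) ^ K := by
  unfold Rbif
  rw [sub_self, abs_zero, Real.zero_rpow (by positivity), sub_zero, ← two_mul,
    Real.mul_rpow (by norm_num) (by positivity), ← mul_assoc, ← Real.rpow_add (by norm_num)]
  simp

lemma Rbif_comm (H K s t : ℝ) : Rbif H K s t = Rbif H K t s := by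
  unfold Rbif; rw [abs_sub_comm, add_comm]

lemma sq_pow_eq {H K ε : ℝ} (hε : 0 < ε) : (ε ^ (H * K)) ^ 2 = ε ^ (2 * H * K) := by
  rw [← Real.rpow_natCast, ← Real.rpow_mul hε.le]; congr 1; push_cast; ring

lemma gc_comm (H K ε s t : ℝ) : gc H K ε s t = gc H K ε t s := by
  unfold gc
  rw [Rbif_comm H K (s + ε) (t + ε), Rbif_comm H K (s + ε) t, Rbif_comm H K s (t + ε),
    Rbif_comm H K s t]; ring

lemma gc_diag {H K : ℝ} (hH : 0 < H) (hK : 0 < K) {ε t : ℝ} (hε : 0 < ε) (ht : 0 ≤ t) :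
    gc H K ε t t = (2:ℝ) ^ (1 - K) + ((t ^ (2 * H)) ^ K + ((t + ε) ^ (2 * H)) ^ K
      - (2:ℝ) ^ (1 - K) * (t ^ (2 * H) + (t + ε) ^ (2 * H)) ^ K) / ε ^ (2 * H * K) := by
  unfold gc
  rw [Rbif_comm H K (t + ε) t, Rbif_diag hH hK ht, Rbif_diag hH hK (by positivity), sq_pow_eq hε]
  have h : Rbif H K t (t + ε) = (2:ℝ) ^ (1 - K) / 2 *
      ((t ^ (2 * H) + (t + ε) ^ (2 * H)) ^ K - ε ^ (2 * H * K)) := by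
    unfold Rbif
    rw [add_sub_cancel_left, abs_of_pos hε, Real.rpow_sub (by norm_num), Real.rpow_neg (by norm_num),
      add_comm (t ^ _), Real.rpow_one]
    ring
  rw [h]
  have : 0 < ε ^ (2 * H * K) := by positivity
  field_simp
  ring

lemma gc_diag_le {H K : ℝ} (hH : 0 < H) (hK : 0 < K) (hK1 : K ≤ 1) {ε t : ℝ} (hε : 0 < ε)
    (ht : 0 ≤ t) : gc H K ε t t ≤ 2 := by
  rw [gc_diag hH hK hε ht]
  have h1 := midconc hK.le hK1 (x := t ^ (2 * H)) (y := (t + ε) ^ (2 * H)) (by positivity)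
    (by positivity)
  have h2 : (2:ℝ) ^ (1 - K) ≤ 2 ^ (1:ℝ) := Real.rpow_le_rpow_of_exponent_le (by norm_num) (by linarith)
  rw [Real.rpow_one] at h2
  have h3 := div_nonpos_of_nonpos_of_nonneg (sub_nonpos.2 h1)
    (by positivity : 0 ≤ ε ^ (2 * H * K))
  linarith

lemma conc_upper {K : ℝ} (h0 : 0 < K) (h1 : K ≤ 1) {x y : ℝ} (hx : 0 < x) (hxy : x ≤ y) :
    (2:ℝ) ^ (1 - K) * (x + y) ^ K - x ^ K - y ^ K ≤
      (K * x ^ (K - 1) - K * y ^ (K - 1)) * ((y - x) / 2) := by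
  have hy : 0 < y := by linarith
  have e : (2:ℝ) ^ (1 - K) * (x + y) ^ K = 2 * ((x + y) / 2) ^ K := by
    rw [Real.div_rpow (by positivity) (by norm_num), Real.rpow_sub (by norm_num), Real.rpow_one]
    ring
  rw [e]
  have tang : ∀ z w : ℝ, 0 < z → 0 < w → w ^ K ≤ z ^ K + K * z ^ (K - 1) * (w - z) := by
    intro z w hz hw
    have hb := rpow_one_add_le_one_add_mul_self (s := w / z - 1)
      (by have := div_pos hw hz; linarith) h0.le h1
    rw [add_sub_cancel, Real.div_rpow hw.le hz.le, div_le_iff₀ (by positivity)] at hb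
    rw [Real.rpow_sub hz, Real.rpow_one]
    refine hb.trans (le_of_eq ?_)
    field_simp
  have t1 := tang x ((x + y)/2) hx (by positivity)
  have t2 := tang y ((x + y)/2) hy (by positivity)
  nlinarith

lemma gc_diag_tendsto {H K : ℝ} (hH : 0 < H) (hH1 : H < 1) (hK : 0 < K) (hK1 : K ≤ 1) {t : ℝ}
    (ht : 0 < t) : Tendsto (fun ε => gc H K ε t t) (𝓝[>] 0) (𝓝 ((2:ℝ) ^ (1 - K))) := by
  -- lower bound
  have hx : (0:ℝ) < t ^ (2 * H) := by positivity
  have d1 : DifferentiableAt ℝ (fun ε : ℝ => (t + ε) ^ (2 * H)) 0 := by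
    apply DifferentiableAt.rpow_const
    · fun_prop
    · left; simpa using ht.ne'
  have d2 : DifferentiableAt ℝ (fun ε : ℝ => K * ((t + ε) ^ (2 * H)) ^ (K - 1)) 0 := by
    apply DifferentiableAt.const_mul
    apply DifferentiableAt.rpow_const d1
    left; simpa using hx.ne'
  have o1 := d1.isBigO_sub
  have o2 := d2.isBigO_sub
  have o3 := o2.mul o1
  simp only [sub_zero, add_zero] at o3
  obtain ⟨C, hC⟩ := o3.bound
  have hlim : Tendsto (fun ε : ℝ => (2:ℝ) ^ (1 - K) - C * ε ^ (2 - 2 * H * K)) (𝓝[>] 0)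
      (𝓝 ((2:ℝ) ^ (1 - K))) := by
    have hp : 0 < 2 - 2 * H * K := by nlinarith
    have : Tendsto (fun ε : ℝ => ε ^ (2 - 2 * H * K)) (𝓝[>] 0) (𝓝 0) := by
      have := (Real.continuousAt_rpow_const 0 (2 - 2 * H * K) (Or.inr hp.le)).tendsto
      rw [Real.zero_rpow hp.ne'] at this
      exact this.mono_left nhdsWithin_le_nhds
    simpa using (tendsto_const_nhds (x := (2:ℝ) ^ (1 - K))).sub (this.const_mul C)
  refine tendsto_of_tendsto_of_tendsto_of_le_of_le' hlim tendsto_const_nhds ?_ ?_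
  · filter_upwards [nhdsWithin_le_nhds hC, self_mem_nhdsWithin] with ε hε hε0
    have hε0 : 0 < ε := hε0
    rw [gc_diag hH hK hε0 ht.le]
    have hm : t ^ (2 * H) ≤ (t + ε) ^ (2 * H) := by gcongr; linarith
    have h1 := conc_upper hK hK1 hx hm
    set y := (t + ε) ^ (2 * H)
    set x := t ^ (2 * H)
    have h2 : (K * x ^ (K - 1) - K * y ^ (K - 1)) * ((y - x) / 2) ≤ C * ε ^ 2 := by
      have h3 : ‖(K * y ^ (K - 1) - K * x ^ (K - 1)) * (y - x)‖ ≤ C * ‖ε * ε‖ := hε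
      rw [Real.norm_eq_abs, Real.norm_eq_abs, abs_of_pos (mul_pos hε0 hε0)] at h3
      have h4 := neg_abs_le ((K * y ^ (K - 1) - K * x ^ (K - 1)) * (y - x))
      have h5 := abs_nonneg ((K * y ^ (K - 1) - K * x ^ (K - 1)) * (y - x))
      nlinarith
    have h6 : C * ε ^ (2 - 2 * H * K) = C * ε ^ 2 / ε ^ (2 * H * K) := by
      rw [Real.rpow_sub hε0]; norm_num; ring
    rw [h6]
    have : -(C * ε ^ 2 / ε ^ (2 * H * K)) ≤
      (x ^ K + y ^ K - 2 ^ (1 - K) * (x + y) ^ K) / ε ^ (2 * H * K) := by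
      rw [← neg_div]
      gcongr
      linarith
    linarith
  · filter_upwards [self_mem_nhdsWithin] with ε hε0
    have hε0 : 0 < ε := hε0
    rw [gc_diag hH hK hε0 ht.le]
    have h1 := midconc hK.le hK1 (x := t ^ (2 * H)) (y := (t + ε) ^ (2 * H)) (by positivity)
      (by positivity)
    have h3 := div_nonpos_of_nonpos_of_nonneg (sub_nonpos.2 h1)
      (by positivity : 0 ≤ ε ^ (2 * H * K))
    linarith

lemma shift1 {f : ℝ → ℝ} (hf : Continuous f) {M ε : ℝ} (hε : 0 < ε) (hε1 : ε ≤ 1)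
    (hM : ∀ t, 0 ≤ t → t ≤ 2 → |f t| ≤ M) :
    |∫ t in (0:ℝ)..1, (f (t + ε) - f t)| ≤ 2 * ε * M := by
  have hi : ∀ a b, IntervalIntegrable f volume a b := fun a b => hf.intervalIntegrable a b
  rw [intervalIntegral.integral_sub ((by fun_prop : Continuous fun t => f (t + ε)).intervalIntegrable _ _)
    (hi _ _), intervalIntegral.integral_comp_add_right,
    intervalIntegral.integral_interval_sub_interval_comm (hi _ _) (hi _ _) (hi _ _)]
  have h1 : ‖∫ x in (0 + ε)..0, f x‖ ≤ M * |0 - (0 + ε)| := by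
    apply intervalIntegral.norm_integral_le_of_norm_le_const
    intro x hx
    rw [Set.uIoc_of_ge (by linarith)] at hx
    exact hM x (by linarith [hx.1]) (by linarith [hx.2])
  have h2 : ‖∫ x in (1 + ε)..1, f x‖ ≤ M * |1 - (1 + ε)| := by
    apply intervalIntegral.norm_integral_le_of_norm_le_const
    intro x hx
    rw [Set.uIoc_of_ge (by linarith)] at hx
    exact hM x (by linarith [hx.1]) (by linarith [hx.2])
  have e1 : |0 - (0 + ε)| = ε := by rw [zero_add, zero_sub, abs_neg, abs_of_pos hε]
  have e2 : |1 - (1 + ε)| = ε := by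
    rw [show 1 - (1 + ε) = -ε by ring, abs_neg, abs_of_pos hε]
  rw [e1] at h1; rw [e2] at h2
  rw [Real.norm_eq_abs] at h1 h2
  have := abs_sub (∫ x in (0 + ε)..0, f x) (∫ x in (1 + ε)..1, f x)
  linarith

lemma shift2 {g : ℝ → ℝ → ℝ} (hg : Continuous (Function.uncurry g)) {M ε : ℝ} (hε : 0 < ε)
    (hε1 : ε ≤ 1) (hM : ∀ s t, 0 ≤ s → s ≤ 2 → 0 ≤ t → t ≤ 2 → |g s t| ≤ M) :
    |∫ t in (0:ℝ)..1, ∫ s in (0:ℝ)..1,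
      (g (s + ε) (t + ε) - g (s + ε) t - g s (t + ε) + g s t)| ≤ 4 * ε ^ 2 * M := by
  have hc : ∀ {u v : ℝ × ℝ → ℝ}, Continuous u → Continuous v → Continuous fun p => g (u p) (v p) :=
    fun hu hv => hg.comp (hu.prodMk hv)
  have hc1 : ∀ {u v : ℝ → ℝ}, Continuous u → Continuous v → Continuous fun p => g (u p) (v p) :=
    fun hu hv => hg.comp (hu.prodMk hv)
  set f : ℝ → ℝ := fun t => ∫ s in (0:ℝ)..1, (g (s + ε) t - g s t) with hfdef
  have hf : Continuous f := by
    apply intervalIntegral.continuous_parametric_intervalIntegral_of_continuous'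
    exact (hc (u := fun p => p.2 + ε) (v := fun p => p.1) (by fun_prop) (by fun_prop)).sub
      (hc (u := fun p => p.2) (v := fun p => p.1) (by fun_prop) (by fun_prop))
  have hfb : ∀ t, 0 ≤ t → t ≤ 2 → |f t| ≤ 2 * ε * M := by
    intro t h0 h2
    exact shift1 (f := fun s => g s t) (hc1 (by fun_prop) (by fun_prop)) hε hε1
      (fun s hs hs2 => hM s t hs hs2 h0 h2)
  have := shift1 hf hε hε1 hfb
  have e : ∀ t, f (t + ε) - f t = ∫ s in (0:ℝ)..1,
      (g (s + ε) (t + ε) - g (s + ε) t - g s (t + ε) + g s t) := by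
    intro t
    rw [hfdef]
    simp only
    rw [← intervalIntegral.integral_sub]
    · congr 1; ext s; ring
    · exact ((hc1 (by fun_prop) (by fun_prop)).sub (hc1 (by fun_prop) (by fun_prop))).intervalIntegrable _ _
    · exact ((hc1 (by fun_prop) (by fun_prop)).sub (hc1 (by fun_prop) (by fun_prop))).intervalIntegrable _ _
  simp only [e] at this
  refine this.trans (le_of_eq (by ring))

/-- Lebesgue measure on the unit interval -/
noncomputable def nu01 : Measure ℝ := volume.restrict (Set.Icc 0 1)

instance : IsProbabilityMeasure nu01 := ⟨by simp [nu01]⟩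

lemma integrable_cont2 {g : ℝ → ℝ → ℝ} (hg : Continuous (Function.uncurry g)) :
    Integrable (fun p : ℝ × ℝ => g p.1 p.2) (nu01.prod nu01) := by
  unfold nu01
  rw [Measure.prod_restrict]
  have : Continuous (fun p : ℝ × ℝ => g p.1 p.2) := hg
  exact this.continuousOn.integrableOn_compact (isCompact_Icc.prod isCompact_Icc)

lemma int_prod_eq {g : ℝ → ℝ → ℝ} (hg : Continuous (Function.uncurry g)) :
    ∫ p : ℝ × ℝ, g p.1 p.2 ∂(nu01.prod nu01) = ∫ t in (0:ℝ)..1, ∫ s in (0:ℝ)..1, g s t := by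
  rw [integral_prod_symm _ (integrable_cont2 hg)]
  simp only [intervalIntegral.integral_of_le zero_le_one, nu01, integral_Icc_eq_integral_Ioc]

lemma shift2' {g : ℝ → ℝ → ℝ} (hg : Continuous (Function.uncurry g)) {M ε : ℝ} (hε : 0 < ε)
    (hε1 : ε ≤ 1) (hM : ∀ s t, 0 ≤ s → s ≤ 2 → 0 ≤ t → t ≤ 2 → |g s t| ≤ M) :
    Integrable (fun p : ℝ × ℝ => (g (p.1 + ε) (p.2 + ε) - g (p.1 + ε) p.2 - g p.1 (p.2 + ε)
      + g p.1 p.2)) (nu01.prod nu01) ∧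
    |∫ p : ℝ × ℝ, (g (p.1 + ε) (p.2 + ε) - g (p.1 + ε) p.2 - g p.1 (p.2 + ε) + g p.1 p.2)
      ∂(nu01.prod nu01)| ≤ 4 * ε ^ 2 * M := by
  have hc : ∀ {u v : ℝ × ℝ → ℝ}, Continuous u → Continuous v → Continuous fun p => g (u p) (v p) :=
    fun hu hv => hg.comp (hu.prodMk hv)
  have hC : Continuous (Function.uncurry fun s t : ℝ =>
      (g (s + ε) (t + ε) - g (s + ε) t - g s (t + ε) + g s t)) := by
    refine (((hc ?_ ?_).sub (hc ?_ ?_)).sub (hc ?_ ?_)).add (hc ?_ ?_) <;> fun_prop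
  refine ⟨integrable_cont2 hC, ?_⟩
  rw [int_prod_eq hC]
  exact shift2 hg hε hε1 hM

lemma diag_strip {ε : ℝ} (hε : 0 < ε) :
    Integrable (fun p : ℝ × ℝ => if |p.2 - p.1| < ε then (1:ℝ) else 0) (nu01.prod nu01) ∧
    ∫ p : ℝ × ℝ, (if |p.2 - p.1| < ε then (1:ℝ) else 0) ∂(nu01.prod nu01) ≤ 2 * ε := by
  have hms : MeasurableSet {p : ℝ × ℝ | |p.2 - p.1| < ε} :=
    measurableSet_lt (by fun_prop) (by fun_prop)
  have hm : Measurable (fun p : ℝ × ℝ => if |p.2 - p.1| < ε then (1:ℝ) else 0) :=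
    Measurable.ite hms measurable_const measurable_const
  have hi : Integrable (fun p : ℝ × ℝ => if |p.2 - p.1| < ε then (1:ℝ) else 0)
      (nu01.prod nu01) := by
    refine Integrable.of_bound hm.aestronglyMeasurable 1 (ae_of_all _ fun p => ?_)
    split_ifs <;> simp
  refine ⟨hi, ?_⟩
  rw [integral_prod _ hi]
  have hb : ∀ x : ℝ, ∫ y, (if |y - x| < ε then (1:ℝ) else 0) ∂nu01 ≤ 2 * ε := by
    intro x
    have : (fun y : ℝ => if |y - x| < ε then (1:ℝ) else 0) =
        (Metric.ball x ε).indicator (fun _ => 1) := by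
      ext y; simp [Set.indicator, Metric.mem_ball, Real.dist_eq]
    rw [this, integral_indicator Metric.isOpen_ball.measurableSet]
    simp only [integral_const, smul_eq_mul, mul_one, measureReal_restrict_apply_univ]
    have h1 : nu01 (Metric.ball x ε) ≤ volume (Metric.ball x ε) := Measure.restrict_apply_le _ _
    rw [Real.volume_ball] at h1
    exact ENNReal.toReal_le_of_le_ofReal (by positivity) h1
  calc ∫ x, ∫ y, (if |y - x| < ε then (1:ℝ) else 0) ∂nu01 ∂nu01
      ≤ ∫ x, 2 * ε ∂nu01 := by
        refine integral_mono hi.integral_prod_left (integrable_const _) hb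
    _ = 2 * ε := by simp

lemma gc_integral {H K : ℝ} (hH : 0 < H) (hH1 : H < 1) (hK : 0 < K) (hK1 : K ≤ 1) :
    ∃ C : ℝ, 0 ≤ C ∧ ∀ ε : ℝ, 0 < ε → ε ≤ 1 →
      ∫ p : ℝ × ℝ, |gc H K ε p.1 p.2| ∂(nu01.prod nu01) ≤
        C * ε ^ (min 1 (2 - 2 * H * K)) := by
  have hq : 0 < 2 * H * K := by positivity
  have hq2 : 2 * H * K ≤ 2 := by nlinarith
  obtain ⟨η, hη, hs⟩ := phi_sign hq.le
  set g : ℝ → ℝ → ℝ := fun s t => (t ^ (2 * H) + s ^ (2 * H)) ^ K with hgdef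
  set φ : ℝ → ℝ → ℝ := fun s t => |t - s| ^ (2 * H * K) with hφdef
  have cg : Continuous (Function.uncurry g) := by
    refine Continuous.rpow_const ?_ (fun _ => Or.inr hK.le)
    refine Continuous.add ?_ ?_
    · exact Continuous.rpow_const (by fun_prop) (fun _ => Or.inr (by positivity))
    · exact Continuous.rpow_const (by fun_prop) (fun _ => Or.inr (by positivity))
  have cφ : Continuous (Function.uncurry φ) := by
    exact Continuous.rpow_const (by fun_prop) (fun _ => Or.inr (by positivity))
  set M : ℝ := ((2:ℝ) ^ (2 * H) + 2 ^ (2 * H)) ^ K with hM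
  have bg : ∀ s t : ℝ, 0 ≤ s → s ≤ 2 → 0 ≤ t → t ≤ 2 → |g s t| ≤ M := by
    intro s t h1 h2 h3 h4
    rw [abs_of_nonneg (by positivity)]
    simp only [hgdef, hM]
    gcongr
  have bφ : ∀ s t : ℝ, 0 ≤ s → s ≤ 2 → 0 ≤ t → t ≤ 2 → |φ s t| ≤ 2 ^ (2 * H * K) := by
    intro s t h1 h2 h3 h4
    rw [abs_of_nonneg (by positivity)]
    simp only [hφdef]
    gcongr
    rw [abs_le]; constructor <;> linarith
  have hM0 : 0 ≤ M := by positivity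
  refine ⟨4 * M + 4 * 2 ^ (2 * H * K) + 64, by positivity, fun ε hε hε1 => ?_⟩
  obtain ⟨ig, Ig⟩ := shift2' cg hε hε1 bg
  obtain ⟨iφ, Iφ⟩ := shift2' cφ hε hε1 bφ
  obtain ⟨id, Id⟩ := diag_strip hε
  have hp : 0 < ε ^ (2 * H * K) := by positivity
  set Dg : ℝ × ℝ → ℝ := fun p => g (p.1 + ε) (p.2 + ε) - g (p.1 + ε) p.2 - g p.1 (p.2 + ε) + g p.1 p.2
  set Dφ : ℝ × ℝ → ℝ := fun p => φ (p.1 + ε) (p.2 + ε) - φ (p.1 + ε) p.2 - φ p.1 (p.2 + ε) + φ p.1 p.2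
  set dd : ℝ × ℝ → ℝ := fun p => if |p.2 - p.1| < ε then (1:ℝ) else 0
  have hgc : ∀ p : ℝ × ℝ, gc H K ε p.1 p.2 = 2 ^ (-K) * (Dg p - Dφ p) / ε ^ (2 * H * K) := by
    intro p
    unfold gc
    rw [sq_pow_eq hε]
    simp only [Rbif, Dg, Dφ, hgdef, hφdef]
    congr 1; ring
  have hpt : ∀ᵐ p ∂(nu01.prod nu01), |gc H K ε p.1 p.2| ≤
      (-Dg p + η * Dφ p + 32 * ε ^ (2 * H * K) * dd p) / ε ^ (2 * H * K) := by
    have hmem : ∀ᵐ p ∂(nu01.prod nu01), p ∈ Set.Icc (0:ℝ) 1 ×ˢ Set.Icc (0:ℝ) 1 := by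
      unfold nu01
      rw [Measure.prod_restrict]
      exact ae_restrict_mem (measurableSet_Icc.prod measurableSet_Icc)
    filter_upwards [hmem] with p hp'
    obtain ⟨⟨h1, h2⟩, h3, h4⟩ := hp'
    rw [hgc, abs_div, abs_of_pos hp]
    gcongr
    rw [abs_mul]
    have hk1 : |(2:ℝ) ^ (-K)| ≤ 1 := by
      rw [abs_of_pos (by positivity)]
      exact Real.rpow_le_one_of_one_le_of_nonpos (by norm_num) (by linarith)
    have hD : |Dg p| = - Dg p := by
      apply abs_of_nonpos
      have a1 : p.1 ^ (2 * H) ≤ (p.1 + ε) ^ (2 * H) := by gcongr; linarith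
      have a2 : p.2 ^ (2 * H) ≤ (p.2 + ε) ^ (2 * H) := by gcongr; linarith
      have := conc4 hK.le hK1 (m := p.2 ^ (2 * H) + p.1 ^ (2 * H))
        (p := (p.2 + ε) ^ (2 * H) - p.2 ^ (2 * H)) (q := (p.1 + ε) ^ (2 * H) - p.1 ^ (2 * H))
        (by positivity) (by linarith) (by linarith)
      have i1 : p.2 ^ (2 * H) + p.1 ^ (2 * H) + ((p.2 + ε) ^ (2 * H) - p.2 ^ (2 * H)) +
        ((p.1 + ε) ^ (2 * H) - p.1 ^ (2 * H)) = (p.2 + ε) ^ (2 * H) + (p.1 + ε) ^ (2 * H) := by ring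
      have i2 : p.2 ^ (2 * H) + p.1 ^ (2 * H) + ((p.2 + ε) ^ (2 * H) - p.2 ^ (2 * H)) =
         (p.2 + ε) ^ (2 * H) + p.1 ^ (2 * H) := by ring
      have i3 : p.2 ^ (2 * H) + p.1 ^ (2 * H) + ((p.1 + ε) ^ (2 * H) - p.1 ^ (2 * H)) =
         p.2 ^ (2 * H) + (p.1 + ε) ^ (2 * H) := by ring
      rw [i1, i2, i3] at this
      simp only [Dg, hgdef]
      linarith
    have hDφ : Dφ p = 2 * |p.2 - p.1| ^ (2 * H * K) - |p.2 - p.1 - ε| ^ (2 * H * K)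
        - |p.2 - p.1 + ε| ^ (2 * H * K) := by
      simp only [Dφ, hφdef]
      rw [show p.2 + ε - (p.1 + ε) = p.2 - p.1 by ring,
        show p.2 - (p.1 + ε) = p.2 - p.1 - ε by ring,
        show p.2 + ε - p.1 = p.2 - p.1 + ε by ring]
      ring
    have hφ2 : |Dφ p| ≤ η * Dφ p + 32 * ε ^ (2 * H * K) * dd p := by
      have habs : |η * Dφ p| = |Dφ p| := by rw [abs_mul, hη, one_mul]
      by_cases hlt : |p.2 - p.1| < ε
      · simp only [dd, if_pos hlt, mul_one]
        have hbd : |Dφ p| ≤ 16 * ε ^ (2 * H * K) := by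
          have h2e : (2 * ε) ^ (2 * H * K) ≤ 4 * ε ^ (2 * H * K) := by
            rw [Real.mul_rpow (by norm_num) hε.le]
            gcongr
            calc (2:ℝ) ^ (2 * H * K) ≤ 2 ^ (2:ℝ) :=
                  Real.rpow_le_rpow_of_exponent_le (by norm_num) hq2
              _ = 4 := by norm_num
          have hlt' := abs_lt.1 hlt
          have b1 : |p.2 - p.1| ^ (2 * H * K) ≤ (2 * ε) ^ (2 * H * K) := by
            gcongr; linarith
          have b2 : |p.2 - p.1 - ε| ^ (2 * H * K) ≤ (2 * ε) ^ (2 * H * K) := by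
            gcongr; rw [abs_le]; constructor <;> linarith
          have b3 : |p.2 - p.1 + ε| ^ (2 * H * K) ≤ (2 * ε) ^ (2 * H * K) := by
            gcongr; rw [abs_le]; constructor <;> linarith
          have c1 : 0 ≤ |p.2 - p.1| ^ (2 * H * K) := by positivity
          have c2 : 0 ≤ |p.2 - p.1 - ε| ^ (2 * H * K) := by positivity
          have c3 : 0 ≤ |p.2 - p.1 + ε| ^ (2 * H * K) := by positivity
          rw [hDφ, abs_le]; constructor <;> linarith
        have := neg_abs_le (η * Dφ p)
        linarith
      · have h0 := hs ε (p.2 - p.1) hε.le (not_lt.1 hlt)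
        rw [← hDφ] at h0
        simp only [dd, if_neg hlt, mul_zero, add_zero]
        rw [← habs, abs_of_nonneg h0]
    calc |(2:ℝ) ^ (-K)| * |Dg p - Dφ p| ≤ 1 * (|Dg p| + |Dφ p|) := by
          gcongr
          exact abs_sub _ _
      _ ≤ _ := by rw [hD]; linarith
  have hIntg : Integrable (fun p => (-Dg p + η * Dφ p + 32 * ε ^ (2 * H * K) * dd p) / ε ^ (2 * H * K))
      (nu01.prod nu01) := ((ig.neg.add (iφ.const_mul η)).add (id.const_mul _)).div_const _
  have hle : ∫ p : ℝ × ℝ, |gc H K ε p.1 p.2| ∂(nu01.prod nu01) ≤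
      ∫ p : ℝ × ℝ, (-Dg p + η * Dφ p + 32 * ε ^ (2 * H * K) * dd p) / ε ^ (2 * H * K)
        ∂(nu01.prod nu01) :=
    integral_mono_of_nonneg (ae_of_all _ fun p => abs_nonneg _) hIntg hpt
  refine hle.trans ?_
  rw [integral_div, integral_add (by exact ig.neg.add (iφ.const_mul η)) (id.const_mul _),
    integral_add (f := fun a => -Dg a) ig.neg (iφ.const_mul η), integral_neg, integral_const_mul, integral_const_mul]
  rw [div_le_iff₀ hp]
  have j1 := neg_abs_le (∫ p, Dg p ∂(nu01.prod nu01))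
  have j2 : η * ∫ p, Dφ p ∂(nu01.prod nu01) ≤ 4 * ε ^ 2 * 2 ^ (2 * H * K) := by
    refine (le_abs_self _).trans ?_
    rw [abs_mul, hη, one_mul]; exact Iφ
  have j3 : 32 * ε ^ (2 * H * K) * ∫ p, dd p ∂(nu01.prod nu01) ≤ 64 * (ε ^ (2 * H * K) * ε) := by
    calc _ ≤ 32 * ε ^ (2 * H * K) * (2 * ε) := by gcongr
      _ = _ := by ring
  have k1 : ε ^ 2 ≤ ε ^ (min 1 (2 - 2 * H * K)) * ε ^ (2 * H * K) := by
    rw [← Real.rpow_add hε, ← Real.rpow_natCast]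
    apply Real.rpow_le_rpow_of_exponent_ge hε hε1
    have := min_le_right 1 (2 - 2 * H * K)
    push_cast; linarith
  have k2 : ε ^ (2 * H * K) * ε ≤ ε ^ (min 1 (2 - 2 * H * K)) * ε ^ (2 * H * K) := by
    rw [mul_comm]
    gcongr
    nth_rewrite 1 [← Real.rpow_one ε]
    exact Real.rpow_le_rpow_of_exponent_ge hε hε1 (min_le_left _ _)
  have h4 : (0:ℝ) ≤ 2 ^ (2 * H * K) := by positivity
  have l1 := mul_le_mul_of_nonneg_left k1 hM0
  have l2 := mul_le_mul_of_nonneg_left k1 h4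
  linarith

lemma Rbif_continuous {H K : ℝ} (hH : 0 < H) (hK : 0 < K) :
    Continuous (Function.uncurry (Rbif H K)) := by
  unfold Rbif
  refine Continuous.mul continuous_const (Continuous.sub ?_ ?_)
  · refine Continuous.rpow_const ?_ (fun _ => Or.inr hK.le)
    refine Continuous.add ?_ ?_
    · exact Continuous.rpow_const (by fun_prop) (fun _ => Or.inr (by positivity))
    · exact Continuous.rpow_const (by fun_prop) (fun _ => Or.inr (by positivity))
  · exact Continuous.rpow_const (by fun_prop) (fun _ => Or.inr (by positivity))

lemma gc_continuous {H K : ℝ} (hH : 0 < H) (hK : 0 < K) (ε : ℝ) :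
    Continuous (Function.uncurry (gc H K ε)) := by
  have hR := Rbif_continuous hH hK
  have hc : ∀ {u v : ℝ × ℝ → ℝ}, Continuous u → Continuous v →
    Continuous fun p => Rbif H K (u p) (v p) := fun hu hv => hR.comp (hu.prodMk hv)
  refine Continuous.div_const ?_ _
  refine (((hc ?_ ?_).sub (hc ?_ ?_)).sub (hc ?_ ?_)).add (hc ?_ ?_) <;> fun_prop

section gauss
variable {Ω : Type*} [MeasurableSpace Ω] {μ : Measure Ω}

lemma gauss_sq (v : NNReal) : ∫ x, x ^ 2 ∂(gaussianReal 0 v) = v := by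
  have h := variance_fun_id_gaussianReal (μ := 0) (v := v)
  rw [variance_eq_integral measurable_id'.aemeasurable] at h
  simpa using h

lemma gauss_cos (θ : ℝ) (v : NNReal) :
    ∫ x, Real.cos (θ * x) ∂(gaussianReal 0 v) = Real.exp (-(θ ^ 2 * v / 2)) := by
  have h := charFun_gaussianReal (μ := 0) (v := v) θ
  rw [charFun_apply_real] at h
  have hi : Integrable (fun x : ℝ => Complex.exp (θ * x * Complex.I)) (gaussianReal 0 v) := by
    refine Integrable.of_bound (by fun_prop) 1 (ae_of_all _ fun x => ?_)
    rw [← Complex.ofReal_mul, Complex.norm_exp_ofReal_mul_I]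
  have h2 := congrArg Complex.re h
  have h3 := integral_re (𝕜 := ℂ) hi
  simp only [RCLike.re_eq_complex_re] at h3
  rw [← h3] at h2
  have e1 : ∀ x : ℝ, (Complex.exp (θ * x * Complex.I)).re = Real.cos (θ * x) := by
    intro x; rw [← Complex.ofReal_mul, Complex.exp_ofReal_mul_I_re]
  simp only [e1] at h2
  rw [h2]
  rw [show ((θ:ℂ) * (0:ℝ) * Complex.I - v * θ ^ 2 / 2) = ((-(θ ^ 2 * v / 2) : ℝ) : ℂ) by
    push_cast; ring]
  rw [Complex.exp_ofReal_re]

lemma gauss_sin (θ : ℝ) (v : NNReal) :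
    ∫ x, Real.sin (θ * x) ∂(gaussianReal 0 v) = 0 := by
  have h := charFun_gaussianReal (μ := 0) (v := v) θ
  rw [charFun_apply_real] at h
  have hi : Integrable (fun x : ℝ => Complex.exp (θ * x * Complex.I)) (gaussianReal 0 v) := by
    refine Integrable.of_bound (by fun_prop) 1 (ae_of_all _ fun x => ?_)
    rw [← Complex.ofReal_mul, Complex.norm_exp_ofReal_mul_I]
  have h2 := congrArg Complex.im h
  have h3 := integral_im (𝕜 := ℂ) hi
  simp only [RCLike.im_eq_complex_im] at h3
  rw [← h3] at h2
  have e1 : ∀ x : ℝ, (Complex.exp (θ * x * Complex.I)).im = Real.sin (θ * x) := by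
    intro x; rw [← Complex.ofReal_mul, Complex.exp_ofReal_mul_I_im]
  simp only [e1] at h2
  rw [h2]
  rw [show ((θ:ℂ) * (0:ℝ) * Complex.I - v * θ ^ 2 / 2) = ((-(θ ^ 2 * v / 2) : ℝ) : ℂ) by
    push_cast; ring]
  rw [Complex.exp_ofReal_im]

lemma gauss_cosh_int (v : NNReal) : Integrable Real.cosh (gaussianReal 0 v) := by
  have h1 := integrable_exp_mul_gaussianReal (μ := 0) (v := v) 1
  have h2 := integrable_exp_mul_gaussianReal (μ := 0) (v := v) (-1)
  have := (h1.add h2).div_const 2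
  refine this.congr (ae_of_all _ fun x => ?_)
  simp [Real.cosh_eq]

lemma gauss_cosh (v : NNReal) :
    ∫ x, Real.cosh x ∂(gaussianReal 0 v) = Real.exp (v / 2) := by
  have h1 := integrable_exp_mul_gaussianReal (μ := 0) (v := v) 1
  have h2 := integrable_exp_mul_gaussianReal (μ := 0) (v := v) (-1)
  have m1 := congrFun (mgf_fun_id_gaussianReal (μ := 0) (v := v)) 1
  have m2 := congrFun (mgf_fun_id_gaussianReal (μ := 0) (v := v)) (-1)
  simp only [mgf] at m1 m2
  simp only [Real.cosh_eq]
  simp only [one_mul, neg_one_mul] at h1 h2 m1 m2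
  rw [integral_div, integral_add h1 h2, m1, m2]
  norm_num

/-- Test functions for which second moments of functionals can be computed. -/
structure GoodFn (f F k G : ℝ → ℝ) (σ C : ℝ) : Prop where
  cf : Continuous f
  ck : Continuous k
  cF : Continuous F
  C0 : 0 ≤ C
  intf : ∀ v : NNReal, Integrable f (gaussianReal 0 v)
  meanf : ∀ v : NNReal, ∫ x, f x ∂(gaussianReal 0 v) = F v
  intk : ∀ v : NNReal, Integrable k (gaussianReal 0 v)
  meank : ∀ v : NNReal, ∫ x, k x ∂(gaussianReal 0 v) = G v
  prod : ∀ x y, f x * f y = (k (x - y) + σ * k (x + y)) / 2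
  bddF : ∀ v, 0 ≤ v → v ≤ 2 → |F v| ≤ C
  cov : ∀ a b c, 0 ≤ a → a ≤ 2 → 0 ≤ b → b ≤ 2 → 0 ≤ a + b + 2 * c → 0 ≤ a + b - 2 * c →
    |(G (a + b - 2 * c) + σ * G (a + b + 2 * c)) / 2 - F a * F b| ≤ C * |c|

lemma exp_lip {x y M : ℝ} (hx : x ≤ M) (hy : y ≤ M) :
    |Real.exp x - Real.exp y| ≤ Real.exp M * |x - y| := by
  wlog h : y ≤ x generalizing x y
  · rw [abs_sub_comm, abs_sub_comm x]; exact this hy hx (by linarith)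
  rw [abs_of_nonneg (by linarith [Real.exp_le_exp.2 h]), abs_of_nonneg (by linarith)]
  have h1 : Real.exp y = Real.exp x * Real.exp (y - x) := by rw [← Real.exp_add]; ring_nf
  have h2 := Real.add_one_le_exp (y - x)
  have h3 := Real.exp_le_exp.2 hx
  have h4 := Real.exp_pos x
  nlinarith

lemma good_cos (θ : ℝ) : GoodFn (fun x => Real.cos (θ * x)) (fun v => Real.exp (-(θ ^ 2 * v / 2)))
    (fun x => Real.cos (θ * x)) (fun v => Real.exp (-(θ ^ 2 * v / 2))) 1 (θ ^ 2 + 1) := by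
  have hi : ∀ v : NNReal, Integrable (fun x => Real.cos (θ * x)) (gaussianReal 0 v) := by
    intro v
    refine Integrable.of_bound (by fun_prop) 1 (ae_of_all _ fun x => ?_)
    exact Real.abs_cos_le_one _
  refine ⟨by fun_prop, by fun_prop, by fun_prop, by positivity, hi, gauss_cos θ, hi, gauss_cos θ,
    ?_, ?_, ?_⟩
  · intro x y
    rw [mul_sub, mul_add, Real.cos_sub, Real.cos_add]; ring
  · intro v h0 _
    rw [abs_of_pos (Real.exp_pos _)]
    have : Real.exp (-(θ ^ 2 * v / 2)) ≤ 1 := by rw [Real.exp_le_one_iff]; have : 0 ≤ θ ^ 2 * v / 2 := by positivity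
                                                 linarith
    nlinarith [sq_nonneg θ]
  · intro a b c ha _ hb _ h1 h2
    rw [← Real.exp_add]
    have e1 := exp_lip (x := -(θ ^ 2 * (a + b - 2 * c) / 2)) (y := -(θ ^ 2 * a / 2) + -(θ ^ 2 * b / 2))
      (M := 0) (by have : 0 ≤ θ ^ 2 * (a + b - 2 * c) / 2 := by positivity
                   linarith) (by
                   have : 0 ≤ θ ^ 2 * a / 2 := by positivity
                   have : 0 ≤ θ ^ 2 * b / 2 := by positivity
                   linarith)
    have e2 := exp_lip (x := -(θ ^ 2 * (a + b + 2 * c) / 2)) (y := -(θ ^ 2 * a / 2) + -(θ ^ 2 * b / 2))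
      (M := 0) (by have : 0 ≤ θ ^ 2 * (a + b + 2 * c) / 2 := by positivity
                   linarith) (by
                   have : 0 ≤ θ ^ 2 * a / 2 := by positivity
                   have : 0 ≤ θ ^ 2 * b / 2 := by positivity
                   linarith)
    rw [show -(θ ^ 2 * (a + b - 2 * c) / 2) - (-(θ ^ 2 * a / 2) + -(θ ^ 2 * b / 2)) = θ ^ 2 * c by ring,
      abs_mul, Real.exp_zero, one_mul, abs_of_nonneg (sq_nonneg θ)] at e1
    rw [show -(θ ^ 2 * (a + b + 2 * c) / 2) - (-(θ ^ 2 * a / 2) + -(θ ^ 2 * b / 2)) = - (θ ^ 2 * c) by ring,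
      abs_neg, abs_mul, Real.exp_zero, one_mul, abs_of_nonneg (sq_nonneg θ)] at e2
    have hc := abs_nonneg c
    rw [abs_le] at e1 e2 ⊢
    constructor <;> nlinarith [e1.1, e1.2, e2.1, e2.2]

lemma good_sin (θ : ℝ) : GoodFn (fun x => Real.sin (θ * x)) (fun _ => 0)
    (fun x => Real.cos (θ * x)) (fun v => Real.exp (-(θ ^ 2 * v / 2))) (-1) (θ ^ 2 + 1) := by
  have hi : ∀ v : NNReal, Integrable (fun x => Real.cos (θ * x)) (gaussianReal 0 v) := by
    intro v
    refine Integrable.of_bound (by fun_prop) 1 (ae_of_all _ fun x => ?_)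
    exact Real.abs_cos_le_one _
  have hi' : ∀ v : NNReal, Integrable (fun x => Real.sin (θ * x)) (gaussianReal 0 v) := by
    intro v
    refine Integrable.of_bound (by fun_prop) 1 (ae_of_all _ fun x => ?_)
    exact Real.abs_sin_le_one _
  refine ⟨by fun_prop, by fun_prop, by fun_prop, by positivity, hi', gauss_sin θ, hi, gauss_cos θ,
    ?_, ?_, ?_⟩
  · intro x y
    rw [mul_sub, mul_add, Real.cos_sub, Real.cos_add]; ring
  · intro v h0 _
    rw [abs_zero]; positivity
  · intro a b c ha _ hb _ h1 h2
    have e1 := exp_lip (x := -(θ ^ 2 * (a + b - 2 * c) / 2)) (y := -(θ ^ 2 * (a + b + 2 * c) / 2))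
      (M := 0) (by have : 0 ≤ θ ^ 2 * (a + b - 2 * c) / 2 := by positivity
                   linarith) (by
                   have : 0 ≤ θ ^ 2 * (a + b + 2 * c) / 2 := by positivity
                   linarith)
    rw [show -(θ ^ 2 * (a + b - 2 * c) / 2) - -(θ ^ 2 * (a + b + 2 * c) / 2) = 2 * (θ ^ 2 * c) by ring,
      abs_mul, abs_mul, Real.exp_zero, one_mul, abs_of_nonneg (sq_nonneg θ), abs_two] at e1
    have hc := abs_nonneg c
    rw [abs_le] at e1 ⊢
    constructor <;> nlinarith [e1.1, e1.2]

lemma good_cosh : GoodFn Real.cosh (fun v => Real.exp (v / 2)) Real.cosh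
    (fun v => Real.exp (v / 2)) 1 (Real.exp 4) := by
  refine ⟨by fun_prop, by fun_prop, by fun_prop, by positivity, gauss_cosh_int, gauss_cosh,
    gauss_cosh_int, gauss_cosh, ?_, ?_, ?_⟩
  · intro x y
    rw [Real.cosh_sub, Real.cosh_add]; ring
  · intro v h0 h2
    rw [abs_of_pos (Real.exp_pos _)]
    exact Real.exp_le_exp.2 (by linarith)
  · intro a b c ha ha2 hb hb2 h1 h2
    rw [← Real.exp_add]
    have e1 := exp_lip (x := (a + b - 2 * c) / 2) (y := a / 2 + b / 2) (M := 4)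
      (by linarith) (by linarith)
    have e2 := exp_lip (x := (a + b + 2 * c) / 2) (y := a / 2 + b / 2) (M := 4)
      (by linarith) (by linarith)
    rw [show (a + b - 2 * c) / 2 - (a / 2 + b / 2) = - c by ring, abs_neg] at e1
    rw [show (a + b + 2 * c) / 2 - (a / 2 + b / 2) = c by ring] at e2
    rw [abs_le] at e1 e2 ⊢
    constructor <;> linarith [e1.1, e1.2, e2.1, e2.2]

end gauss

section proc
variable {Ω : Type*} [MeasurableSpace Ω] {μ : Measure Ω} {H K : ℝ} {B : ℝ → Ω → ℝ}

/-- normalised increments -/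
noncomputable def ZZ (B : ℝ → Ω → ℝ) (γ ε t : ℝ) (ω : Ω) : ℝ := (B (t + ε) ω - B t ω) / ε ^ γ

lemma law_int {X : Ω → ℝ} (hX : Measurable X) {v : NNReal} (h : μ.map X = gaussianReal 0 v)
    {f : ℝ → ℝ} (hf : Continuous f) : ∫ ω, f (X ω) ∂μ = ∫ x, f x ∂(gaussianReal 0 v) := by
  rw [← h, integral_map hX.aemeasurable hf.aestronglyMeasurable]

lemma law_integrable {X : Ω → ℝ} (hX : Measurable X) {v : NNReal} (h : μ.map X = gaussianReal 0 v)
    {f : ℝ → ℝ} (hf : Continuous f) (hi : Integrable f (gaussianReal 0 v)) :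
    Integrable (fun ω => f (X ω)) μ := by
  rw [← h] at hi
  exact (integrable_map_measure hf.aestronglyMeasurable hX.aemeasurable).1 hi

lemma B_meas (hmeas : Measurable (fun p : ℝ × Ω => B p.1 p.2)) (t : ℝ) : Measurable (B t) :=
  hmeas.comp (measurable_const.prodMk measurable_id)

lemma gauss_sq_int (v : NNReal) : Integrable (fun x : ℝ => x ^ 2) (gaussianReal 0 v) := by
  have := (memLp_id_gaussianReal (μ := 0) (v := v) 2).integrable_sq
  simpa using this

lemma B_memLp (hB : IsBifBM μ H K B) (hmeas : Measurable (fun p : ℝ × Ω => B p.1 p.2))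
    {t : ℝ} (ht : 0 ≤ t) : MemLp (B t) 2 μ := by
  rw [memLp_two_iff_integrable_sq (B_meas hmeas t).aestronglyMeasurable]
  have h := hB.2 1 (fun _ => t) (fun _ => ht) (fun _ => 1)
  simp only [Finset.univ_unique, Finset.sum_singleton, one_mul] at h
  exact law_integrable (f := fun x => x ^ 2) (B_meas hmeas t) h (by fun_prop) (gauss_sq_int _)

lemma B_cov (hH : 0 < H) (hK : 0 < K) (hB : IsBifBM μ H K B)
    (hmeas : Measurable (fun p : ℝ × Ω => B p.1 p.2)) {s t : ℝ} (hs : 0 ≤ s) (ht : 0 ≤ t) :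
    ∫ ω, B s ω * B t ω ∂μ = Rbif H K s t := by
  have hm := B_meas hmeas
  have one : ∀ t, 0 ≤ t → ∫ ω, B t ω ^ 2 ∂μ = Rbif H K t t := by
    intro t ht
    have h := hB.2 1 (fun _ => t) (fun _ => ht) (fun _ => 1)
    simp only [Finset.univ_unique, Finset.sum_singleton, one_mul] at h
    rw [law_int (f := fun x => x ^ 2) (hm t) h (by fun_prop), gauss_sq, Real.coe_toNNReal]
    rw [Rbif_diag hH hK ht]; positivity
  have two : ∀ c : ℝ, ∫ ω, (B s ω + c * B t ω) ^ 2 ∂μ =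
      max (Rbif H K s s + 2 * c * Rbif H K s t + c ^ 2 * Rbif H K t t) 0 := by
    intro c
    have h := hB.2 2 ![s, t] (by intro i; fin_cases i <;> simpa) ![1, c]
    simp only [Fin.sum_univ_two, Matrix.cons_val_zero, Matrix.cons_val_one, one_mul] at h
    rw [law_int (X := fun ω => B s ω + c * B t ω) (f := fun x => x ^ 2) ((hm s).add ((hm t).const_mul c)) h (by fun_prop), gauss_sq, Real.coe_toNNReal']
    congr 1
    rw [Rbif_comm H K t s]; ring
  have Ls := B_memLp hB hmeas hs
  have Lt := B_memLp hB hmeas ht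
  have is := Ls.integrable_sq
  have it := Lt.integrable_sq
  have ist : Integrable (fun ω => B s ω * B t ω) μ := Ls.integrable_mul Lt
  have exp : ∀ c : ℝ, ∫ ω, (B s ω + c * B t ω) ^ 2 ∂μ =
      Rbif H K s s + 2 * c * ∫ ω, B s ω * B t ω ∂μ + c ^ 2 * Rbif H K t t := by
    intro c
    have : ∀ ω, (B s ω + c * B t ω) ^ 2 = B s ω ^ 2 + 2 * c * (B s ω * B t ω) + c ^ 2 * B t ω ^ 2 := by
      intro ω; ring
    simp only [this]
    rw [integral_add (by exact is.add (ist.const_mul _)) (it.const_mul _),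
      integral_add is (ist.const_mul _), integral_const_mul, integral_const_mul, one s hs, one t ht]
  have p1 := exp 1
  have p2 := exp (-1)
  rw [two] at p1 p2
  have q1 := le_max_left (Rbif H K s s + 2 * 1 * Rbif H K s t + 1 ^ 2 * Rbif H K t t) 0
  have q2 := le_max_left (Rbif H K s s + 2 * (-1) * Rbif H K s t + (-1) ^ 2 * Rbif H K t t) 0
  linarith

lemma quad_nonneg (hH : 0 < H) (hK : 0 < K) (hB : IsBifBM μ H K B)
    (hmeas : Measurable (fun p : ℝ × Ω => B p.1 p.2)) {n : ℕ} (t : Fin n → ℝ)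
    (ht : ∀ i, 0 ≤ t i) (a : Fin n → ℝ) :
    0 ≤ ∑ i, ∑ j, a i * a j * Rbif H K (t i) (t j) := by
  have : ∑ i, ∑ j, a i * a j * Rbif H K (t i) (t j) = ∫ ω, (∑ i, a i * B (t i) ω) ^ 2 ∂μ := by
    have e : ∀ ω, (∑ i, a i * B (t i) ω) ^ 2 =
        ∑ i, ∑ j, a i * a j * (B (t i) ω * B (t j) ω) := by
      intro ω
      rw [sq, Finset.sum_mul_sum]
      refine Finset.sum_congr rfl fun i _ => Finset.sum_congr rfl fun j _ => by ring
    simp only [e]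
    have hi : ∀ i j, Integrable (fun ω => a i * a j * (B (t i) ω * B (t j) ω)) μ := fun i j =>
      ((B_memLp hB hmeas (ht i)).integrable_mul (B_memLp hB hmeas (ht j))).const_mul _
    rw [integral_finsetSum _ (fun i _ => integrable_finsetSum _ (fun j _ => hi i j))]
    refine Finset.sum_congr rfl fun i _ => ?_
    rw [integral_finsetSum _ (fun j _ => hi i j)]
    refine Finset.sum_congr rfl fun j _ => ?_
    rw [integral_const_mul, B_cov hH hK hB hmeas (ht i) (ht j)]
  rw [this]
  exact integral_nonneg fun ω => sq_nonneg _

lemma Z_meas (hmeas : Measurable (fun p : ℝ × Ω => B p.1 p.2)) (γ ε t : ℝ) :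
    Measurable (ZZ B γ ε t) :=
  ((B_meas hmeas _).sub (B_meas hmeas _)).div_const _

lemma law_comb (hH : 0 < H) (hK : 0 < K) (hB : IsBifBM μ H K B)
    (hmeas : Measurable (fun p : ℝ × Ω => B p.1 p.2)) {ε s t : ℝ} (hε : 0 < ε)
    (hs : 0 ≤ s) (ht : 0 ≤ t) (c : ℝ) :
    0 ≤ gc H K ε s s + c ^ 2 * gc H K ε t t + 2 * c * gc H K ε s t ∧
    μ.map (fun ω => ZZ B (H * K) ε s ω + c * ZZ B (H * K) ε t ω) = gaussianReal 0
      (Real.toNNReal (gc H K ε s s + c ^ 2 * gc H K ε t t + 2 * c * gc H K ε s t)) := by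
  have hp : 0 < ε ^ (H * K) := by positivity
  set r := (ε ^ (H * K))⁻¹ with hr
  have hpos : ∀ i, 0 ≤ (![s + ε, s, t + ε, t] : Fin 4 → ℝ) i := by
    intro i; fin_cases i <;> simp <;> linarith
  have h := hB.2 4 ![s + ε, s, t + ε, t] hpos ![r, -r, c * r, -(c * r)]
  have h0 := quad_nonneg hH hK hB hmeas ![s + ε, s, t + ε, t] hpos ![r, -r, c * r, -(c * r)]
  have e : ∑ i, ∑ j, (![r, -r, c * r, -(c * r)] : Fin 4 → ℝ) i *
      (![r, -r, c * r, -(c * r)] : Fin 4 → ℝ) j *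
      Rbif H K ((![s + ε, s, t + ε, t] : Fin 4 → ℝ) i) ((![s + ε, s, t + ε, t] : Fin 4 → ℝ) j) =
      gc H K ε s s + c ^ 2 * gc H K ε t t + 2 * c * gc H K ε s t := by
    simp only [Fin.sum_univ_four, Matrix.cons_val]
    unfold gc
    rw [div_eq_mul_inv, div_eq_mul_inv, div_eq_mul_inv, ← inv_pow, ← hr,
      Rbif_comm H K (t + ε) (s + ε), Rbif_comm H K (t + ε) s, Rbif_comm H K t (s + ε),
      Rbif_comm H K t s]
    ring
  rw [e] at h h0
  refine ⟨h0, ?_⟩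
  rw [← h]
  congr 1
  ext ω
  simp only [Fin.sum_univ_four, Matrix.cons_val, ZZ]
  rw [div_eq_mul_inv, div_eq_mul_inv, ← hr]
  ring

lemma law_Z (hH : 0 < H) (hK : 0 < K) (hB : IsBifBM μ H K B)
    (hmeas : Measurable (fun p : ℝ × Ω => B p.1 p.2)) {ε t : ℝ} (hε : 0 < ε) (ht : 0 ≤ t) :
    0 ≤ gc H K ε t t ∧
    μ.map (ZZ B (H * K) ε t) = gaussianReal 0 (Real.toNNReal (gc H K ε t t)) := by
  have := law_comb hH hK hB hmeas hε ht ht 0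
  simpa using this

lemma good_mean (hH : 0 < H) (hK : 0 < K) (hB : IsBifBM μ H K B)
    (hmeas : Measurable (fun p : ℝ × Ω => B p.1 p.2)) {ε t : ℝ} (hε : 0 < ε) (ht : 0 ≤ t)
    {f F k G : ℝ → ℝ} {σ C : ℝ} (hf : GoodFn f F k G σ C) :
    Integrable (fun ω => f (ZZ B (H * K) ε t ω)) μ ∧
    ∫ ω, f (ZZ B (H * K) ε t ω) ∂μ = F (gc H K ε t t) := by
  obtain ⟨h0, h⟩ := law_Z hH hK hB hmeas hε ht
  refine ⟨law_integrable (Z_meas hmeas _ _ _) h hf.cf (hf.intf _), ?_⟩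
  rw [law_int (Z_meas hmeas _ _ _) h hf.cf, hf.meanf, Real.coe_toNNReal _ h0]

lemma good_cov (hH : 0 < H) (hK : 0 < K) (hK1 : K ≤ 1) (hB : IsBifBM μ H K B)
    (hmeas : Measurable (fun p : ℝ × Ω => B p.1 p.2)) {ε s t : ℝ} (hε : 0 < ε) (hs : 0 ≤ s)
    (ht : 0 ≤ t) {f F k G : ℝ → ℝ} {σ C : ℝ} (hf : GoodFn f F k G σ C) :
    Integrable (fun ω => f (ZZ B (H * K) ε s ω) * f (ZZ B (H * K) ε t ω)) μ ∧
    |∫ ω, f (ZZ B (H * K) ε s ω) * f (ZZ B (H * K) ε t ω) ∂μ -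
      F (gc H K ε s s) * F (gc H K ε t t)| ≤ C * |gc H K ε s t| := by
  obtain ⟨hp0, hp⟩ := law_comb hH hK hB hmeas hε hs ht 1
  obtain ⟨hm0, hm⟩ := law_comb hH hK hB hmeas hε hs ht (-1)
  simp only [one_mul, one_pow, mul_one] at hp0 hp
  have e : gc H K ε s s + (-1) ^ 2 * gc H K ε t t + 2 * -1 * gc H K ε s t =
    gc H K ε s s + gc H K ε t t - 2 * gc H K ε s t := by ring
  rw [e] at hm0 hm
  simp only [neg_one_mul, ← sub_eq_add_neg] at hm
  have mp : Measurable fun ω => ZZ B (H * K) ε s ω + ZZ B (H * K) ε t ω :=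
    (Z_meas hmeas _ _ _).add (Z_meas hmeas _ _ _)
  have mm : Measurable fun ω => ZZ B (H * K) ε s ω - ZZ B (H * K) ε t ω :=
    (Z_meas hmeas _ _ _).sub (Z_meas hmeas _ _ _)
  have ip := law_integrable mp hp hf.ck (hf.intk _)
  have im := law_integrable mm hm hf.ck (hf.intk _)
  simp only [hf.prod]
  refine ⟨(im.add (ip.const_mul σ)).div_const 2, ?_⟩
  rw [integral_div, integral_add im (ip.const_mul σ), integral_const_mul,
    law_int mp hp hf.ck, law_int mm hm hf.ck, hf.meank, hf.meank, Real.coe_toNNReal _ hp0,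
    Real.coe_toNNReal _ hm0]
  exact hf.cov _ _ _ (law_Z hH hK hB hmeas hε hs).1 (gc_diag_le hH hK hK1 hε hs)
    (law_Z hH hK hB hmeas hε ht).1 (gc_diag_le hH hK hK1 hε ht) hp0 hm0

end proc

section var
variable {Ω : Type*} [MeasurableSpace Ω] {μ : Measure Ω} {H K : ℝ} {B : ℝ → Ω → ℝ}

lemma Z_meas2 (hmeas : Measurable (fun p : ℝ × Ω => B p.1 p.2)) (γ ε : ℝ) :
    Measurable (fun p : ℝ × Ω => ZZ B γ ε p.1 p.2) := by
  unfold ZZ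
  refine Measurable.div_const (Measurable.sub ?_ hmeas) _
  exact hmeas.comp ((measurable_fst.add_const ε).prodMk measurable_snd)

lemma var_bound [IsProbabilityMeasure μ] (hH : 0 < H) (hK : 0 < K) (hK1 : K ≤ 1) (hB : IsBifBM μ H K B)
    (hmeas : Measurable (fun p : ℝ × Ω => B p.1 p.2)) {ε : ℝ} (hε : 0 < ε)
    {f F k G : ℝ → ℝ} {σ C : ℝ} (hf : GoodFn f F k G σ C) {ν : Measure ℝ} (hν : ν ≤ nu01) :
    Integrable (fun ω => (∫ t, (f (ZZ B (H * K) ε t ω) - F (gc H K ε t t)) ∂ν) ^ 2) μ ∧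
    ∫ ω, (∫ t, (f (ZZ B (H * K) ε t ω) - F (gc H K ε t t)) ∂ν) ^ 2 ∂μ ≤
      C * ∫ p : ℝ × ℝ, |gc H K ε p.1 p.2| ∂(nu01.prod nu01) := by
  have : IsFiniteMeasure ν := isFiniteMeasure_of_le nu01 hν
  set g : ℝ → Ω → ℝ := fun t ω => f (ZZ B (H * K) ε t ω) - F (gc H K ε t t) with hg
  have hgm : Measurable (fun p : ℝ × Ω => g p.1 p.2) := by
    have h1 : Measurable (fun t => F (gc H K ε t t)) :=
      (hf.cF.comp ((gc_continuous hH hK ε).comp (continuous_id.prodMk continuous_id))).measurable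
    exact (hf.cf.measurable.comp (Z_meas2 hmeas _ _)).sub (h1.comp measurable_fst)
  have pt : ∀ s t, 0 ≤ s → 0 ≤ t → Integrable (fun ω => g s ω * g t ω) μ ∧
      |∫ ω, g s ω * g t ω ∂μ| ≤ C * |gc H K ε s t| := by
    intro s t hs ht
    obtain ⟨i1, m1⟩ := good_mean hH hK hB hmeas hε hs hf
    obtain ⟨i2, m2⟩ := good_mean hH hK hB hmeas hε ht hf
    obtain ⟨i3, m3⟩ := good_cov hH hK hK1 hB hmeas hε hs ht hf
    set fs := fun ω => f (ZZ B (H * K) ε s ω) with hfs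
    set ft := fun ω => f (ZZ B (H * K) ε t ω) with hft
    set Fs := F (gc H K ε s s)
    set Ft := F (gc H K ε t t)
    have e : (fun ω => g s ω * g t ω) = fun ω => fs ω * ft ω - Fs * ft ω - Ft * fs ω + Fs * Ft := by
      ext ω; simp only [hg, hfs, hft]; ring
    rw [e]
    have j1 : Integrable (fun ω => fs ω * ft ω - Fs * ft ω) μ := i3.sub (i2.const_mul Fs)
    have j2 : Integrable (fun ω => fs ω * ft ω - Fs * ft ω - Ft * fs ω) μ := j1.sub (i1.const_mul Ft)
    refine ⟨j2.add (integrable_const _), ?_⟩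
    rw [integral_add j2 (integrable_const _), integral_sub j1 (i1.const_mul Ft),
      integral_sub i3 (i2.const_mul Fs), integral_const_mul, integral_const_mul, m1, m2,
      integral_const]
    simp only [probReal_univ, one_smul]
    convert m3 using 2
    ring
  have sq : ∀ s, 0 ≤ s → ∫ ω, g s ω ^ 2 ∂μ ≤ C * 2 := by
    intro s hs
    have h := (pt s s hs hs).2
    rw [abs_of_nonneg (law_Z hH hK hB hmeas hε hs).1] at h
    simp only [← sq] at h
    refine (le_abs_self _).trans (h.trans ?_)
    exact mul_le_mul_of_nonneg_left (gc_diag_le hH hK hK1 hε hs) hf.C0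
  have hle : ν.prod ν ≤ nu01.prod nu01 := Measure.prod_mono hν hν
  have hmem : ∀ᵐ p ∂(ν.prod ν), p ∈ Set.Icc (0:ℝ) 1 ×ˢ Set.Icc (0:ℝ) 1 := by
    apply (Measure.absolutelyContinuous_of_le hle).ae_le
    unfold nu01
    rw [Measure.prod_restrict]
    exact ae_restrict_mem (measurableSet_Icc.prod measurableSet_Icc)
  have hm3 : Measurable (fun q : (ℝ × ℝ) × Ω => g q.1.1 q.2 * g q.1.2 q.2) :=
    (hgm.comp ((measurable_fst.comp measurable_fst).prodMk measurable_snd)).mul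
      (hgm.comp ((measurable_snd.comp measurable_fst).prodMk measurable_snd))
  have hIntg : Integrable (fun q : (ℝ × ℝ) × Ω => g q.1.1 q.2 * g q.1.2 q.2)
      ((ν.prod ν).prod μ) := by
    rw [integrable_prod_iff hm3.aestronglyMeasurable]
    constructor
    · filter_upwards [hmem] with p hp
      exact (pt p.1 p.2 hp.1.1 hp.2.1).1
    · refine Integrable.of_bound (C := C * 2) hm3.norm.stronglyMeasurable.integral_prod_right'.aestronglyMeasurable ?_
      filter_upwards [hmem] with p hp
      rw [Real.norm_eq_abs, abs_of_nonneg (integral_nonneg fun _ => norm_nonneg _)]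
      have i1 : Integrable (fun ω => g p.1 ω ^ 2) μ := by
        simpa only [pow_two] using (pt p.1 p.1 hp.1.1 hp.1.1).1
      have i2 : Integrable (fun ω => g p.2 ω ^ 2) μ := by
        simpa only [pow_two] using (pt p.2 p.2 hp.2.1 hp.2.1).1
      calc ∫ ω, ‖g p.1 ω * g p.2 ω‖ ∂μ ≤ ∫ ω, (g p.1 ω ^ 2 + g p.2 ω ^ 2) / 2 ∂μ := by
            refine integral_mono (pt p.1 p.2 hp.1.1 hp.2.1).1.norm ((i1.add i2).div_const 2) ?_
            intro ω
            simp only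
            rw [Real.norm_eq_abs, abs_le]
            constructor <;> nlinarith [sq_nonneg (g p.1 ω + g p.2 ω), sq_nonneg (g p.1 ω - g p.2 ω)]
        _ ≤ C * 2 := by
            rw [integral_div, integral_add i1 i2]
            linarith [sq p.1 hp.1.1, sq p.2 hp.2.1]
  have esq : ∀ ω, (∫ t, g t ω ∂ν) ^ 2 = ∫ p : ℝ × ℝ, g p.1 ω * g p.2 ω ∂(ν.prod ν) := by
    intro ω
    rw [integral_prod_mul (fun s => g s ω) (fun s => g s ω), pow_two]
  change Integrable (fun ω => (∫ t, g t ω ∂ν) ^ 2) μ ∧ ∫ ω, (∫ t, g t ω ∂ν) ^ 2 ∂μ ≤ _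
  simp only [esq]
  refine ⟨hIntg.integral_prod_right, ?_⟩
  rw [← integral_integral_swap (f := fun (p : ℝ × ℝ) ω => g p.1 ω * g p.2 ω) hIntg]
  have igc : Integrable (fun p : ℝ × ℝ => |gc H K ε p.1 p.2|) (nu01.prod nu01) :=
    (integrable_cont2 (gc_continuous hH hK ε)).abs
  calc ∫ p : ℝ × ℝ, ∫ ω, g p.1 ω * g p.2 ω ∂μ ∂(ν.prod ν)
      ≤ ∫ p : ℝ × ℝ, C * |gc H K ε p.1 p.2| ∂(ν.prod ν) := by
        refine integral_mono_ae hIntg.integral_prod_left ((igc.mono_measure hle).const_mul C) ?_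
        filter_upwards [hmem] with p hp
        exact (le_abs_self _).trans (pt p.1 p.2 hp.1.1 hp.2.1).2
    _ ≤ ∫ p : ℝ × ℝ, C * |gc H K ε p.1 p.2| ∂(nu01.prod nu01) := by
        refine integral_mono_measure hle (ae_of_all _ fun p => ?_) (igc.const_mul C)
        exact mul_nonneg hf.C0 (abs_nonneg _)
    _ = _ := by rw [integral_const_mul]

/-- grid -/
noncomputable def eN (m : ℕ) (N : ℕ) : ℝ := ((N:ℝ) ^ m)⁻¹

lemma ae_tendsto_zero_of_sq {S : ℕ → Ω → ℝ} (hi : ∀ n, Integrable (fun ω => S n ω ^ 2) μ)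
    {c : ℕ → ℝ} (hc : Summable c) (h : ∀ n, ∫ ω, S n ω ^ 2 ∂μ ≤ c n) :
    ∀ᵐ ω ∂μ, Tendsto (fun n => S n ω) atTop (𝓝 0) := by
  have hfin : ∫⁻ ω, ∑' n, ENNReal.ofReal (S n ω ^ 2) ∂μ ≠ ⊤ := by
    rw [lintegral_tsum (fun n => (hi n).aemeasurable.ennreal_ofReal)]
    have : ∀ n, ∫⁻ ω, ENNReal.ofReal (S n ω ^ 2) ∂μ ≤ ENNReal.ofReal (c n) := by
      intro n
      rw [← ofReal_integral_eq_lintegral_ofReal (hi n) (ae_of_all _ fun ω => sq_nonneg _)]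
      exact ENNReal.ofReal_le_ofReal (h n)
    refine ne_top_of_le_ne_top ?_ (ENNReal.tsum_le_tsum this)
    exact hc.tsum_ofReal_ne_top
  have hae := ae_lt_top' (AEMeasurable.tsum (fun n => (hi n).aemeasurable.ennreal_ofReal)) hfin
  filter_upwards [hae] with ω hω
  have h1 := ENNReal.tendsto_atTop_zero_of_tsum_ne_top hω.ne
  have h2 := (ENNReal.tendsto_toReal ENNReal.zero_ne_top).comp h1
  simp only [Function.comp_def, ENNReal.toReal_ofReal (sq_nonneg _), ENNReal.toReal_zero] at h2
  have h3 := h2.sqrt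
  simp only [Real.sqrt_sq_eq_abs, Real.sqrt_zero] at h3
  exact (tendsto_zero_iff_abs_tendsto_zero _).2 h3

lemma good_int_prod [IsProbabilityMeasure μ] (hH : 0 < H) (hK : 0 < K) (hK1 : K ≤ 1) (hB : IsBifBM μ H K B)
    (hmeas : Measurable (fun p : ℝ × Ω => B p.1 p.2)) {ε : ℝ} (hε : 0 < ε)
    {f F k G : ℝ → ℝ} {σ C : ℝ} (hf : GoodFn f F k G σ C) {ν : Measure ℝ} (hν : ν ≤ nu01) :
    ∀ᵐ ω ∂μ, Integrable (fun t => f (ZZ B (H * K) ε t ω)) ν := by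
  have : IsFiniteMeasure ν := isFiniteMeasure_of_le nu01 hν
  have hmem : ∀ᵐ t ∂ν, t ∈ Set.Icc (0:ℝ) 1 :=
    (Measure.absolutelyContinuous_of_le hν).ae_le (ae_restrict_mem measurableSet_Icc)
  have hm : Measurable (fun p : ℝ × Ω => f (ZZ B (H * K) ε p.1 p.2)) :=
    hf.cf.measurable.comp (Z_meas2 hmeas _ _)
  have hIntg : Integrable (fun p : ℝ × Ω => f (ZZ B (H * K) ε p.1 p.2)) (ν.prod μ) := by
    rw [integrable_prod_iff hm.aestronglyMeasurable]
    constructor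
    · filter_upwards [hmem] with t ht
      exact (good_mean hH hK hB hmeas hε ht.1 hf).1
    · refine Integrable.of_bound (C := 1 + (C * C + C * 2))
        hm.norm.stronglyMeasurable.integral_prod_right'.aestronglyMeasurable ?_
      filter_upwards [hmem] with t ht
      rw [Real.norm_eq_abs, abs_of_nonneg (integral_nonneg fun _ => norm_nonneg _)]
      obtain ⟨i2, h2⟩ := good_cov hH hK hK1 hB hmeas hε ht.1 ht.1 hf
      have i1 := (good_mean hH hK hB hmeas hε ht.1 hf).1
      have g0 := (law_Z hH hK hB hmeas hε ht.1).1
      have g2 := gc_diag_le hH hK hK1 hε ht.1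
      have hF := hf.bddF _ g0 g2
      have hFF : F (gc H K ε t t) * F (gc H K ε t t) ≤ C * C := by
        rw [← abs_mul_abs_self]
        exact mul_le_mul hF hF (abs_nonneg _) hf.C0
      rw [abs_of_nonneg g0] at h2
      have h3 := mul_le_mul_of_nonneg_left g2 hf.C0
      have h4 := (abs_le.1 h2).2
      calc ∫ ω, ‖f (ZZ B (H * K) ε t ω)‖ ∂μ
          ≤ ∫ ω, (1 + f (ZZ B (H * K) ε t ω) * f (ZZ B (H * K) ε t ω)) ∂μ := by
            refine integral_mono i1.norm ((integrable_const _).add i2) ?_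
            intro ω
            simp only
            rw [Real.norm_eq_abs, abs_le]
            constructor <;> nlinarith [sq_nonneg (f (ZZ B (H * K) ε t ω) - 1), sq_nonneg (f (ZZ B (H * K) ε t ω) + 1)]
        _ = 1 + ∫ ω, f (ZZ B (H * K) ε t ω) * f (ZZ B (H * K) ε t ω) ∂μ := by
            rw [integral_add (integrable_const _) i2]; simp
        _ ≤ _ := by linarith
  exact hIntg.prod_left_ae

lemma mean_tendsto (hH : 0 < H) (hH1 : H < 1) (hK : 0 < K) (hK1 : K ≤ 1) [IsProbabilityMeasure μ]
    (hB : IsBifBM μ H K B)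
    (hmeas : Measurable (fun p : ℝ × Ω => B p.1 p.2)) {ε : ℕ → ℝ} (hε : ∀ n, 0 < ε n)
    (hlim : Tendsto ε atTop (𝓝 0))
    {f F k G : ℝ → ℝ} {σ C : ℝ} (hf : GoodFn f F k G σ C) {ν : Measure ℝ} (hν : ν ≤ nu01) :
    Tendsto (fun n => ∫ t, F (gc H K (ε n) t t) ∂ν) atTop
      (𝓝 (∫ _, F ((2:ℝ) ^ (1 - K)) ∂ν)) := by
  have : IsFiniteMeasure ν := isFiniteMeasure_of_le nu01 hν
  have hmem : ∀ᵐ t ∂ν, t ∈ Set.Icc (0:ℝ) 1 :=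
    (Measure.absolutelyContinuous_of_le hν).ae_le (ae_restrict_mem measurableSet_Icc)
  have hne : ∀ᵐ t ∂ν, t ≠ 0 := by
    have h1 : ∀ᵐ t ∂nu01, t ≠ 0 := by
      unfold nu01
      exact ae_restrict_of_ae (Measure.ae_ne volume 0)
    exact (Measure.absolutelyContinuous_of_le hν).ae_le h1
  refine tendsto_integral_of_dominated_convergence (fun _ => C) ?_ (integrable_const _) ?_ ?_
  · intro n
    exact (hf.cF.comp ((gc_continuous hH hK (ε n)).comp
      (continuous_id.prodMk continuous_id))).aestronglyMeasurable
  · intro n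
    filter_upwards [hmem] with t ht
    exact hf.bddF _ (law_Z hH hK hB hmeas (hε n) ht.1).1 (gc_diag_le hH hK hK1 (hε n) ht.1)
  · filter_upwards [hmem, hne] with t ht h0
    have h := gc_diag_tendsto hH hH1 hK hK1 (lt_of_le_of_ne ht.1 (Ne.symm h0))
    have h2 : Tendsto ε atTop (𝓝[>] 0) :=
      tendsto_nhdsWithin_iff.2 ⟨hlim, Eventually.of_forall hε⟩
    exact (hf.cF.tendsto _).comp (h.comp h2)

lemma eN_pos (m n : ℕ) : 0 < eN m (n + 1) := by unfold eN; positivity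

lemma eN_le_one (m n : ℕ) : eN m (n + 1) ≤ 1 := by
  unfold eN
  apply inv_le_one_of_one_le₀
  apply one_le_pow₀
  push_cast
  have : (0:ℝ) ≤ n := by positivity
  linarith

lemma eN_tendsto {m : ℕ} (hm : m ≠ 0) : Tendsto (fun n => eN m (n + 1)) atTop (𝓝 0) := by
  have h1 : Tendsto (fun N : ℕ => eN m N) atTop (𝓝 0) := by
    unfold eN
    exact tendsto_inv_atTop_zero.comp ((tendsto_pow_atTop hm).comp tendsto_natCast_atTop_atTop)
  exact h1.comp (tendsto_add_atTop_nat 1)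

lemma grid_conv [IsProbabilityMeasure μ] (hH : 0 < H) (hH1 : H < 1) (hK : 0 < K) (hK1 : K ≤ 1)
    (hB : IsBifBM μ H K B)
    (hmeas : Measurable (fun p : ℝ × Ω => B p.1 p.2)) {m : ℕ} (hm0 : m ≠ 0)
    (hm : 2 ≤ m * min 1 (2 - 2 * H * K))
    {f F k G : ℝ → ℝ} {σ C : ℝ} (hf : GoodFn f F k G σ C) {ν : Measure ℝ} (hν : ν ≤ nu01) :
    ∀ᵐ ω ∂μ, (∀ n, Integrable (fun t => f (ZZ B (H * K) (eN m (n + 1)) t ω)) ν) ∧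
      Tendsto (fun n => ∫ t, f (ZZ B (H * K) (eN m (n + 1)) t ω) ∂ν) atTop
        (𝓝 (ν.real Set.univ * F ((2:ℝ) ^ (1 - K)))) := by
  have : IsFiniteMeasure ν := isFiniteMeasure_of_le nu01 hν
  obtain ⟨D, hD0, hD⟩ := gc_integral hH hH1 hK hK1
  have h1 : ∀ᵐ ω ∂μ, ∀ n, Integrable (fun t => f (ZZ B (H * K) (eN m (n + 1)) t ω)) ν :=
    ae_all_iff.2 fun n => good_int_prod hH hK hK1 hB hmeas (eN_pos m n) hf hν
  have hsum : Summable (fun n : ℕ => C * (D * (((n + 1 : ℕ) : ℝ) ^ 2)⁻¹)) := by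
    have : Summable (fun n : ℕ => ((n:ℝ) ^ 2)⁻¹) := Real.summable_nat_pow_inv.2 (by norm_num)
    exact (((summable_nat_add_iff 1).2 this).mul_left D).mul_left C
  have h2 := ae_tendsto_zero_of_sq (μ := μ)
    (fun n => (var_bound hH hK hK1 hB hmeas (eN_pos m n) hf hν).1) hsum (fun n => by
      refine (var_bound hH hK hK1 hB hmeas (eN_pos m n) hf hν).2.trans ?_
      refine mul_le_mul_of_nonneg_left ((hD _ (eN_pos m n) (eN_le_one m n)).trans ?_) hf.C0
      refine mul_le_mul_of_nonneg_left ?_ hD0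
      unfold eN
      have hn : (1:ℝ) ≤ ((n + 1 : ℕ) : ℝ) := by push_cast; have : (0:ℝ) ≤ n := by positivity
                                                linarith
      rw [Real.inv_rpow (by positivity), ← Real.rpow_natCast, ← Real.rpow_natCast,
        ← Real.rpow_mul (by positivity)]
      apply inv_anti₀ (by positivity)
      apply Real.rpow_le_rpow_of_exponent_le hn
      exact_mod_cast hm)
  have h3 := mean_tendsto hH hH1 hK hK1 hB hmeas (eN_pos m) (eN_tendsto hm0) hf hν
  filter_upwards [h1, h2] with ω w1 w2
  refine ⟨w1, ?_⟩
  have h4 := w2.add h3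
  rw [zero_add, integral_const, smul_eq_mul] at h4
  refine h4.congr fun n => ?_
  rw [integral_sub (w1 n)]
  · ring
  · refine Integrable.of_bound (C := C) ((hf.cF.comp ((gc_continuous hH hK (eN m (n+1))).comp
      (continuous_id.prodMk continuous_id))).aestronglyMeasurable) ?_
    have hmem : ∀ᵐ t ∂ν, t ∈ Set.Icc (0:ℝ) 1 :=
      (Measure.absolutelyContinuous_of_le hν).ae_le (ae_restrict_mem measurableSet_Icc)
    filter_upwards [hmem] with t ht
    exact hf.bddF _ (law_Z hH hK hB hmeas (eN_pos m n) ht.1).1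
      (gc_diag_le hH hK hK1 (eN_pos m n) ht.1)

end var


/-- L^p modulus of a path -/
noncomputable def wmod (p : ℕ) (b : ℝ → ℝ) (T h : ℝ) : ENNReal :=
  ∫⁻ t in Set.Icc 0 T, ENNReal.ofReal (|b (t + h) - b t| ^ p)

lemma wmod_meas (p : ℕ) {b : ℝ → ℝ} (hb : Measurable b) (T : ℝ) : Measurable (wmod p b T) := by
  unfold wmod
  have hm : Measurable (fun (q : ℝ × ℝ) => ENNReal.ofReal (|b (q.2 + q.1) - b q.2| ^ p)) := by fun_prop
  exact hm.lintegral_prod_right'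

lemma lint_shift (g : ℝ → ENNReal) {u : ℝ} (hu : 0 ≤ u) (hu1 : u ≤ 1) :
    ∫⁻ t in Set.Icc (0:ℝ) 2, g (t + u) ≤ ∫⁻ t in Set.Icc (0:ℝ) 3, g t := by
  rw [← lintegral_indicator measurableSet_Icc, ← lintegral_indicator measurableSet_Icc,
    ← lintegral_add_right_eq_self (fun t => (Set.Icc (0:ℝ) 3).indicator g t) u]
  refine lintegral_mono fun t => ?_
  by_cases ht : t ∈ Set.Icc (0:ℝ) 2
  · rw [Set.indicator_of_mem ht, Set.indicator_of_mem]
    exact ⟨by linarith [ht.1], by linarith [ht.2]⟩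
  · rw [Set.indicator_of_notMem ht]; exact zero_le

lemma wmod_tri (p : ℕ) {b : ℝ → ℝ} (hb : Measurable b) {u h : ℝ} (hu : 0 ≤ u) (huh : u ≤ h)
    (hh : h ≤ 1) : wmod p b 2 h ≤ 2 ^ p * (wmod p b 3 (h - u) + wmod p b 3 u) := by
  have h1 : wmod p b 2 h ≤ ∫⁻ t in Set.Icc (0:ℝ) 2, 2 ^ p *
      (ENNReal.ofReal (|b (t + u + (h - u)) - b (t + u)| ^ p) + ENNReal.ofReal (|b (t + u) - b t| ^ p)) := by
    unfold wmod
    refine lintegral_mono fun t => ?_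
    have e : (2:ENNReal) ^ p = ENNReal.ofReal (2 ^ p) := by
      rw [ENNReal.ofReal_pow (by norm_num)]; simp
    simp only
    rw [e, ← ENNReal.ofReal_add (by positivity) (by positivity), ← ENNReal.ofReal_mul (by positivity)]
    apply ENNReal.ofReal_le_ofReal
    have e2 : t + u + (h - u) = t + h := by ring
    rw [e2]
    have tri : |b (t + h) - b t| ≤ |b (t + h) - b (t + u)| + |b (t + u) - b t| := abs_sub_le _ _ _
    calc |b (t + h) - b t| ^ p ≤ (|b (t + h) - b (t + u)| + |b (t + u) - b t|) ^ p := by gcongr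
      _ ≤ 2 ^ (p - 1) * (|b (t + h) - b (t + u)| ^ p + |b (t + u) - b t| ^ p) :=
        add_pow_le (abs_nonneg _) (abs_nonneg _) p
      _ ≤ _ := by
        gcongr
        · norm_num
        · omega
  refine h1.trans ?_
  rw [lintegral_const_mul _ (by fun_prop), lintegral_add_left (by fun_prop)]
  gcongr
  · exact lint_shift (fun t => ENNReal.ofReal (|b (t + (h - u)) - b t| ^ p)) hu (huh.trans hh)
  · unfold wmod
    exact lintegral_mono_set (Set.Icc_subset_Icc_right (by norm_num))

lemma wmod_bound (p : ℕ) {b : ℝ → ℝ} (hb : Measurable b) {q h : ℝ} (hq : 0 < q) (hh0 : 0 < h)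
    (hh : h ≤ 1) : wmod p b 2 h ≤ 2 ^ (p + 1) * ENNReal.ofReal (h ^ q) *
      ∫⁻ u in Set.Ioc (0:ℝ) 1, ENNReal.ofReal (u ^ (-1 - q)) * wmod p b 3 u := by
  set G := ∫⁻ u in Set.Ioc (0:ℝ) 1, ENNReal.ofReal (u ^ (-1 - q)) * wmod p b 3 u with hG
  have wm := wmod_meas p hb 3
  have hIntg : ∫⁻ u in Set.Ioo 0 h, wmod p b 3 u ≤ ENNReal.ofReal (h ^ (1 + q)) * G := by
    calc ∫⁻ u in Set.Ioo 0 h, wmod p b 3 u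
        ≤ ∫⁻ u in Set.Ioo 0 h, ENNReal.ofReal (h ^ (1 + q)) * (ENNReal.ofReal (u ^ (-1 - q)) * wmod p b 3 u) := by
          refine setLIntegral_mono' measurableSet_Ioo fun u hu => ?_
          rw [← mul_assoc, ← ENNReal.ofReal_mul (by positivity)]
          refine le_mul_of_one_le_left (zero_le) ?_
          rw [ENNReal.one_le_ofReal]
          have : u ^ (1 + q) ≤ h ^ (1 + q) := Real.rpow_le_rpow hu.1.le hu.2.le (by linarith)
          have e : u ^ (1 + q) * u ^ (-1 - q) = 1 := by
            rw [← Real.rpow_add hu.1]; norm_num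
          exact e.symm.le.trans (mul_le_mul_of_nonneg_right this (Real.rpow_nonneg hu.1.le _))
      _ = ENNReal.ofReal (h ^ (1 + q)) * ∫⁻ u in Set.Ioo 0 h, (ENNReal.ofReal (u ^ (-1 - q)) * wmod p b 3 u) := by
          rw [lintegral_const_mul _ (by fun_prop)]
      _ ≤ _ := by
          gcongr
          exact lintegral_mono_set fun u hu => ⟨hu.1, hu.2.le.trans hh⟩
  have hrefl : ∫⁻ u in Set.Ioo 0 h, wmod p b 3 (h - u) = ∫⁻ u in Set.Ioo 0 h, wmod p b 3 u := by
    rw [← lintegral_indicator measurableSet_Ioo, ← lintegral_indicator measurableSet_Ioo,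
      ← lintegral_sub_left_eq_self (fun t => (Set.Ioo (0:ℝ) h).indicator (wmod p b 3) t) h]
    refine lintegral_congr fun t => ?_
    by_cases ht : t ∈ Set.Ioo (0:ℝ) h
    · rw [Set.indicator_of_mem ht, Set.indicator_of_mem]
      exact ⟨by linarith [ht.2], by linarith [ht.1]⟩
    · rw [Set.indicator_of_notMem ht, Set.indicator_of_notMem]
      intro hc; exact ht ⟨by linarith [hc.2], by linarith [hc.1]⟩
  have h3 : ENNReal.ofReal h * wmod p b 2 h ≤ ENNReal.ofReal h * (2 ^ (p + 1) * ENNReal.ofReal (h ^ q) * G) := by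
    calc ENNReal.ofReal h * wmod p b 2 h = ∫⁻ u in Set.Ioo 0 h, wmod p b 2 h := by
          rw [lintegral_const]; simp [mul_comm]
      _ ≤ ∫⁻ u in Set.Ioo 0 h, 2 ^ p * (wmod p b 3 (h - u) + wmod p b 3 u) :=
          setLIntegral_mono' measurableSet_Ioo fun u hu => wmod_tri p hb hu.1.le hu.2.le hh
      _ = 2 ^ p * ((∫⁻ u in Set.Ioo 0 h, wmod p b 3 u) + ∫⁻ u in Set.Ioo 0 h, wmod p b 3 u) := by
          rw [lintegral_const_mul _ (by fun_prop), lintegral_add_left (by fun_prop), hrefl]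
      _ ≤ 2 ^ p * (ENNReal.ofReal (h ^ (1 + q)) * G + ENNReal.ofReal (h ^ (1 + q)) * G) := by gcongr
      _ = _ := by
          rw [Real.rpow_add hh0, Real.rpow_one, ENNReal.ofReal_mul hh0.le]; ring
  exact (ENNReal.mul_le_mul_iff_right (by simpa using hh0) ENNReal.ofReal_ne_top).1 h3

section modul
variable {Ω : Type*} [MeasurableSpace Ω] {μ : Measure Ω} {H K : ℝ} {B : ℝ → Ω → ℝ}

lemma pow_le_cosh (p : ℕ) (x : ℝ) : |x| ^ p ≤ (p.factorial : ℝ) * 2 * Real.cosh x := by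
  have h1 := Real.pow_div_factorial_le_exp |x| (abs_nonneg x) p
  have hp : (0:ℝ) < p.factorial := by positivity
  rw [div_le_iff₀ hp] at h1
  have h2 : Real.exp |x| ≤ 2 * Real.cosh x := by
    rw [← Real.cosh_abs x, Real.cosh_eq]
    have := Real.exp_pos (-|x|)
    linarith
  nlinarith

lemma Zp_moment [IsProbabilityMeasure μ] (hH : 0 < H) (hK : 0 < K) (hK1 : K ≤ 1) (hB : IsBifBM μ H K B)
    (hmeas : Measurable (fun p : ℝ × Ω => B p.1 p.2)) (p : ℕ) {h t : ℝ} (hh : 0 < h) (ht : 0 ≤ t) :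
    ∫⁻ ω, ENNReal.ofReal (|B (t + h) ω - B t ω| ^ p) ∂μ ≤
      ENNReal.ofReal (h ^ (H * K * p) * ((p.factorial : ℝ) * 2 * Real.exp 1)) := by
  obtain ⟨i, e⟩ := good_mean hH hK hB hmeas hh ht good_cosh
  have hg := gc_diag_le hH hK hK1 hh ht
  have hpos : 0 < h ^ (H * K) := Real.rpow_pos_of_pos hh _
  have hle : ∀ ω, |B (t + h) ω - B t ω| ^ p ≤
      h ^ (H * K * p) * ((p.factorial : ℝ) * 2) * Real.cosh (ZZ B (H * K) h t ω) := by
    intro ω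
    have h1 := pow_le_cosh p (ZZ B (H * K) h t ω)
    have h2 : B (t + h) ω - B t ω = h ^ (H * K) * ZZ B (H * K) h t ω := by
      unfold ZZ; field_simp
    rw [h2, abs_mul, mul_pow, abs_of_pos hpos, Real.rpow_mul_natCast hh.le, mul_assoc]
    gcongr
  calc ∫⁻ ω, ENNReal.ofReal (|B (t + h) ω - B t ω| ^ p) ∂μ
      ≤ ∫⁻ ω, ENNReal.ofReal (h ^ (H * K * p) * ((p.factorial : ℝ) * 2) * Real.cosh (ZZ B (H * K) h t ω)) ∂μ :=
        lintegral_mono fun ω => ENNReal.ofReal_le_ofReal (hle ω)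
    _ = ENNReal.ofReal (∫ ω, h ^ (H * K * p) * ((p.factorial : ℝ) * 2) * Real.cosh (ZZ B (H * K) h t ω) ∂μ) := by
        rw [ofReal_integral_eq_lintegral_ofReal (i.const_mul _)]
        exact Filter.Eventually.of_forall fun ω => by
          have := Real.cosh_pos (ZZ B (H * K) h t ω)
          simp only [Pi.zero_apply]; positivity
    _ ≤ _ := by
        rw [integral_const_mul, e, mul_assoc]
        apply ENNReal.ofReal_le_ofReal
        have : Real.exp (gc H K h t t / 2) ≤ Real.exp 1 := Real.exp_le_exp.2 (by linarith)
        gcongr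

lemma modulus [IsProbabilityMeasure μ] (hH : 0 < H) (hK : 0 < K) (hK1 : K ≤ 1) (hB : IsBifBM μ H K B)
    (hmeas : Measurable (fun p : ℝ × Ω => B p.1 p.2)) {p : ℕ} (hp : p ≠ 0) {q : ℝ} (hq : 0 < q)
    (hqp : q < H * K * p) :
    ∀ᵐ ω ∂μ, ∃ C : ℝ, 0 ≤ C ∧ ∀ h, 0 ≤ h → h ≤ 1 →
      wmod p (fun t => B t ω) 2 h ≤ ENNReal.ofReal (C * h ^ q) := by
  set M : ℝ := (p.factorial : ℝ) * 2 * Real.exp 1 with hM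
  have hM0 : 0 ≤ M := by positivity
  have hm3 : Measurable (fun x : (Ω × ℝ) × ℝ => ENNReal.ofReal (|B (x.2 + x.1.2) x.1.1 - B x.2 x.1.1| ^ p)) := by
    have h1 : Measurable (fun x : (Ω × ℝ) × ℝ => B (x.2 + x.1.2) x.1.1) :=
      hmeas.comp (f := fun x : (Ω × ℝ) × ℝ => (x.2 + x.1.2, x.1.1)) (by fun_prop)
    have h2 : Measurable (fun x : (Ω × ℝ) × ℝ => B x.2 x.1.1) :=
      hmeas.comp (f := fun x : (Ω × ℝ) × ℝ => (x.2, x.1.1)) (by fun_prop)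
    fun_prop
  have hm2 : Measurable (fun x : Ω × ℝ => wmod p (fun t => B t x.1) 3 x.2) := by
    unfold wmod
    exact hm3.lintegral_prod_right'
  have hm2' : Measurable (fun x : Ω × ℝ => ENNReal.ofReal (x.2 ^ (-1 - q)) * wmod p (fun t => B t x.1) 3 x.2) := by
    have : Measurable (fun x : Ω × ℝ => ENNReal.ofReal (x.2 ^ (-1 - q))) := by fun_prop
    exact this.mul hm2
  set G : Ω → ENNReal := fun ω => ∫⁻ u in Set.Ioc (0:ℝ) 1, ENNReal.ofReal (u ^ (-1 - q)) * wmod p (fun t => B t ω) 3 u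
    with hG
  have hGm : Measurable G := hm2'.lintegral_prod_right'
  have hw : ∀ u, 0 < u → ∫⁻ ω, wmod p (fun t => B t ω) 3 u ∂μ ≤ ENNReal.ofReal (3 * (u ^ (H * K * p) * M)) := by
    intro u hu
    unfold wmod
    have hmu : Measurable (fun x : Ω × ℝ => ENNReal.ofReal (|B (x.2 + u) x.1 - B x.2 x.1| ^ p)) :=
      hm3.comp (g := fun x : (Ω × ℝ) × ℝ => ENNReal.ofReal (|B (x.2 + x.1.2) x.1.1 - B x.2 x.1.1| ^ p))
        (f := fun x : Ω × ℝ => ((x.1, u), x.2)) (by fun_prop)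
    rw [lintegral_lintegral_swap hmu.aemeasurable]
    calc _ ≤ ∫⁻ t in Set.Icc (0:ℝ) 3, ENNReal.ofReal (u ^ (H * K * p) * M) :=
          setLIntegral_mono' measurableSet_Icc fun t ht => Zp_moment hH hK hK1 hB hmeas p hu ht.1
      _ = _ := by
          rw [lintegral_const, ENNReal.ofReal_mul (p := 3) (by norm_num), mul_comm]; simp
  have hE : ∫⁻ ω, G ω ∂μ ≠ ⊤ := by
    rw [hG, lintegral_lintegral_swap hm2'.aemeasurable]
    have h1 : ∫⁻ u in Set.Ioc (0:ℝ) 1, ∫⁻ ω, ENNReal.ofReal (u ^ (-1 - q)) * wmod p (fun t => B t ω) 3 u ∂μ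
        ≤ ∫⁻ u in Set.Ioc (0:ℝ) 1, ENNReal.ofReal (3 * M * u ^ (H * K * p - q - 1)) := by
      refine setLIntegral_mono' measurableSet_Ioc fun u hu => ?_
      rw [lintegral_const_mul]
      · refine (mul_le_mul_right (hw u hu.1) _).trans (le_of_eq ?_)
        rw [← ENNReal.ofReal_mul (Real.rpow_nonneg hu.1.le _)]
        congr 1
        have : u ^ (H * K * p - q - 1) = u ^ (-1 - q) * u ^ (H * K * p) := by
          rw [← Real.rpow_add hu.1]; congr 1; ring
        rw [this]; ring
      · exact hm2.comp (f := fun ω : Ω => (ω, u)) (by fun_prop)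
    refine ne_top_of_le_ne_top ?_ h1
    have hi : IntegrableOn (fun u : ℝ => 3 * M * u ^ (H * K * p - q - 1)) (Set.Ioc 0 1) := by
      have := (intervalIntegral.intervalIntegrable_rpow' (a := 0) (b := 1)
        (by linarith : -1 < H * K * p - q - 1)).const_mul (3 * M)
      exact (intervalIntegrable_iff_integrableOn_Ioc_of_le zero_le_one).1 this
    exact hi.lintegral_lt_top.ne
  filter_upwards [ae_lt_top hGm hE] with ω hω
  have hb : Measurable (fun t => B t ω) := hmeas.comp (f := fun t : ℝ => (t, ω)) (by fun_prop)
  refine ⟨2 ^ (p + 1) * (G ω).toReal, by positivity, fun h h0 h1 => ?_⟩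
  rcases h0.eq_or_lt with rfl | h0
  · simp [wmod, hp]
  · refine (wmod_bound p hb hq h0 h1).trans (le_of_eq ?_)
    have e : (2:ENNReal) ^ (p + 1) = ENNReal.ofReal (2 ^ (p + 1)) := by
      rw [ENNReal.ofReal_pow (by norm_num)]; simp
    rw [ENNReal.ofReal_mul (by positivity), ENNReal.ofReal_mul (by positivity),
      ENNReal.ofReal_toReal hω.ne, e]
    simp only [hG]
    ring

end modul

/-- deterministic normalised increments -/
noncomputable def zd (b : ℝ → ℝ) (γ ε t : ℝ) : ℝ := (b (t + ε) - b t) / ε ^ γ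

lemma zd_meas {b : ℝ → ℝ} (hb : Measurable b) (γ ε : ℝ) : Measurable (zd b γ ε) := by
  unfold zd; fun_prop

lemma lint_shift1 (g : ℝ → ENNReal) {u : ℝ} (hu : 0 ≤ u) (hu1 : u ≤ 1) :
    ∫⁻ t in Set.Icc (0:ℝ) 1, g (t + u) ≤ ∫⁻ t in Set.Icc (0:ℝ) 2, g t := by
  rw [← lintegral_indicator measurableSet_Icc, ← lintegral_indicator measurableSet_Icc,
    ← lintegral_add_right_eq_self (fun t => (Set.Icc (0:ℝ) 2).indicator g t) u]
  refine lintegral_mono fun t => ?_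
  by_cases ht : t ∈ Set.Icc (0:ℝ) 1
  · rw [Set.indicator_of_mem ht, Set.indicator_of_mem]
    exact ⟨by linarith [ht.1], by linarith [ht.2]⟩
  · rw [Set.indicator_of_notMem ht]; exact zero_le

/-- index of the grid point just above `ε` -/
noncomputable def nE (m : ℕ) (ε : ℝ) : ℕ := ⌊ε ^ (-(1 / (m:ℝ)))⌋₊ - 1

lemma nE_tendsto {m : ℕ} (hm : m ≠ 0) : Tendsto (nE m) (𝓝[>] 0) atTop := by
  have hm' : (0:ℝ) < m := by positivity
  have h1 : Tendsto (fun ε : ℝ => ε ^ (-(1 / (m:ℝ)))) (𝓝[>] 0) atTop := by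
    have h2 : Tendsto (fun ε : ℝ => (ε⁻¹) ^ (1 / (m:ℝ))) (𝓝[>] 0) atTop :=
      (tendsto_rpow_atTop (by positivity)).comp tendsto_inv_nhdsGT_zero
    refine h2.congr' ?_
    filter_upwards [self_mem_nhdsWithin] with ε hε
    rw [Real.inv_rpow (le_of_lt hε), Real.rpow_neg (le_of_lt hε)]
  exact (tendsto_sub_atTop_nat 1).comp (tendsto_nat_floor_atTop.comp h1)

lemma one_add_pow_le_lin (m : ℕ) {x : ℝ} (h0 : 0 ≤ x) (h1 : x ≤ 1) :
    (1 + x) ^ m ≤ 1 + (2 ^ m - 1) * x := by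
  induction m with
  | zero => simp
  | succ m ih =>
    have h2 : (1:ℝ) ≤ 2 ^ m := one_le_pow₀ (by norm_num)
    calc (1 + x) ^ (m + 1) = (1 + x) ^ m * (1 + x) := pow_succ _ _
      _ ≤ (1 + (2 ^ m - 1) * x) * (1 + x) := by gcongr
      _ ≤ _ := by
        rw [pow_succ]
        nlinarith [mul_nonneg (mul_nonneg (sub_nonneg.2 h2) h0) (sub_nonneg.2 h1)]

lemma grid_pt {m : ℕ} (hm : m ≠ 0) {ε : ℝ} (h0 : 0 < ε) (h1 : ε ≤ 1) :
    ε ≤ eN m (nE m ε + 1) ∧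
      eN m (nE m ε + 1) - ε ≤ 2 ^ (m + 1) * (ε * ε ^ (1 / (m:ℝ))) := by
  have hm' : (0:ℝ) < m := by positivity
  set y : ℝ := ε ^ (-(1 / (m:ℝ))) with hy
  have hy1 : 1 ≤ y := by
    rw [hy]
    exact Real.one_le_rpow_of_pos_of_le_one_of_nonpos h0 h1 (by rw [neg_nonpos]; positivity)
  have hfl : 1 ≤ ⌊y⌋₊ := (Nat.one_le_floor_iff y).2 hy1
  have hN : nE m ε + 1 = ⌊y⌋₊ := by unfold nE; rw [← hy]; omega
  rw [hN]
  set N := ⌊y⌋₊ with hNd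
  have hNy : (N:ℝ) ≤ y := Nat.floor_le (by linarith)
  have hyN : y < N + 1 := Nat.lt_floor_add_one y
  have hN1 : (1:ℝ) ≤ N := by exact_mod_cast hfl
  have hym : ε * y ^ m = 1 := by
    rw [hy, ← Real.rpow_mul_natCast h0.le]
    have : -(1 / (m:ℝ)) * m = -1 := by field_simp
    rw [this, Real.rpow_neg_one]; field_simp
  have hyi : ε ^ (1 / (m:ℝ)) * y = 1 := by
    rw [hy, ← Real.rpow_add h0]; simp
  unfold eN
  have hNm : (0:ℝ) < (N:ℝ) ^ m := by positivity
  constructor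
  · rw [le_inv_comm₀ h0 hNm]
    rw [← eq_inv_of_mul_eq_one_right hym]
    gcongr
  · have hr : y / N ≤ 1 + 1 / N := by
      rw [div_le_iff₀ (by linarith)]
      field_simp
      linarith
    have hp : (y / N) ^ m ≤ 1 + (2 ^ m - 1) * (1 / N) := by
      refine le_trans ?_ (one_add_pow_le_lin m (by positivity) ?_)
      · have : 0 ≤ y / N := by positivity
        gcongr
      · rw [div_le_one (by linarith)]; exact hN1
    have he : ((N:ℝ) ^ m)⁻¹ = ε * (y / N) ^ m := by
      rw [div_pow, mul_div_assoc', hym, one_div]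
    have hinv : 1 / (N:ℝ) ≤ 2 * ε ^ (1 / (m:ℝ)) := by
      rw [div_le_iff₀ (by linarith)]
      have h3 : 0 ≤ ε ^ (1 / (m:ℝ)) := by positivity
      nlinarith
    rw [he]
    have h2 : (1:ℝ) ≤ 2 ^ m := one_le_pow₀ (by norm_num)
    calc ε * (y / N) ^ m - ε ≤ ε * (1 + (2 ^ m - 1) * (1 / N)) - ε := by gcongr
      _ = ε * ((2 ^ m - 1) * (1 / N)) := by ring
      _ ≤ ε * (2 ^ m * (2 * ε ^ (1 / (m:ℝ)))) := by
        gcongr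
        linarith
      _ = _ := by ring

lemma ratio_tendsto {m : ℕ} (hm : m ≠ 0) :
    Tendsto (fun ε => eN m (nE m ε + 1) / ε) (𝓝[>] 0) (𝓝 1) := by
  have hm' : (0:ℝ) < m := by positivity
  have hup : Tendsto (fun ε : ℝ => 1 + 2 ^ (m + 1) * ε ^ (1 / (m:ℝ))) (𝓝[>] 0) (𝓝 1) := by
    have : Tendsto (fun ε : ℝ => 1 + 2 ^ (m + 1) * ε ^ (1 / (m:ℝ))) (𝓝 0) (𝓝 (1 + 2 ^ (m + 1) * (0:ℝ) ^ (1 / (m:ℝ)))) := by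
      have hc : ContinuousAt (fun ε : ℝ => ε ^ (1 / (m:ℝ))) 0 :=
        Real.continuousAt_rpow_const _ _ (Or.inr (by positivity))
      exact (hc.tendsto.const_mul _).const_add _
    rw [Real.zero_rpow (by positivity), mul_zero, add_zero] at this
    exact this.mono_left nhdsWithin_le_nhds
  refine tendsto_of_tendsto_of_tendsto_of_le_of_le' tendsto_const_nhds hup ?_ ?_
  · filter_upwards [Ioc_mem_nhdsGT zero_lt_one] with ε hε
    rw [le_div_iff₀ hε.1, one_mul]
    exact (grid_pt hm hε.1 hε.2).1
  · filter_upwards [Ioc_mem_nhdsGT zero_lt_one] with ε hε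
    rw [div_le_iff₀ hε.1]
    have := (grid_pt hm hε.1 hε.2).2
    linarith

lemma close_bound {b : ℝ → ℝ} {γ : ℝ} {p m : ℕ} (hm : m ≠ 0) {q C : ℝ} (hC : 0 ≤ C)
    (hq : 0 < q)
    (hw : ∀ h, 0 ≤ h → h ≤ 1 → wmod p b 2 h ≤ ENNReal.ofReal (C * h ^ q)) {ε : ℝ} (h0 : 0 < ε)
    (h1 : ε ≤ 1) :
    ∫⁻ t in Set.Icc (0:ℝ) 1, ENNReal.ofReal (|zd b γ ε t -
        (eN m (nE m ε + 1) / ε) ^ γ * zd b γ (eN m (nE m ε + 1)) t| ^ p) ≤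
      ENNReal.ofReal (C * (2 ^ (m + 1)) ^ q * ε ^ (q * (1 + 1 / (m:ℝ)) - γ * p)) := by
  obtain ⟨g1, g2⟩ := grid_pt hm h0 h1
  set e := eN m (nE m ε + 1) with he
  have he1 : e ≤ 1 := eN_le_one m _
  have he0 : 0 < e := eN_pos m _
  have hpt : ∀ t, |zd b γ ε t - (e / ε) ^ γ * zd b γ e t| ^ p =
      ε ^ (-(γ * p)) * |b (t + ε + (e - ε)) - b (t + ε)| ^ p := by
    intro t
    have e1 : zd b γ ε t - (e / ε) ^ γ * zd b γ e t = -(ε ^ (-γ) * (b (t + ε + (e - ε)) - b (t + ε))) := by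
      unfold zd
      rw [Real.div_rpow he0.le h0.le, Real.rpow_neg h0.le]
      have a1 : e ^ γ ≠ 0 := (Real.rpow_pos_of_pos he0 _).ne'
      have a2 : ε ^ γ ≠ 0 := (Real.rpow_pos_of_pos h0 _).ne'
      have a3 : t + ε + (e - ε) = t + e := by ring
      rw [a3]
      field_simp
      ring
    rw [e1, abs_neg, abs_mul, mul_pow, abs_of_pos (Real.rpow_pos_of_pos h0 _), ← Real.rpow_mul_natCast h0.le,
      neg_mul]
  simp_rw [hpt]
  have hs : ∀ t, ENNReal.ofReal (ε ^ (-(γ * p)) * |b (t + ε + (e - ε)) - b (t + ε)| ^ p) =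
      ENNReal.ofReal (ε ^ (-(γ * p))) * ENNReal.ofReal (|b (t + ε + (e - ε)) - b (t + ε)| ^ p) :=
    fun t => ENNReal.ofReal_mul (by positivity)
  simp_rw [hs]
  rw [lintegral_const_mul' _ _ ENNReal.ofReal_ne_top]
  calc _ ≤ ENNReal.ofReal (ε ^ (-(γ * p))) * wmod p b 2 (e - ε) := by
        gcongr
        exact lint_shift1 (fun t => ENNReal.ofReal (|b (t + (e - ε)) - b t| ^ p)) h0.le h1
    _ ≤ ENNReal.ofReal (ε ^ (-(γ * p))) * ENNReal.ofReal (C * (e - ε) ^ q) := by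
        gcongr
        exact hw _ (by linarith) (by linarith)
    _ = ENNReal.ofReal (ε ^ (-(γ * p)) * (C * (e - ε) ^ q)) := by
        rw [ENNReal.ofReal_mul (p := ε ^ (-(γ * p))) (by positivity)]
    _ ≤ _ := by
        apply ENNReal.ofReal_le_ofReal
        have h3 : (e - ε) ^ q ≤ (2 ^ (m + 1)) ^ q * ε ^ (q * (1 + 1 / (m:ℝ))) := by
          calc (e - ε) ^ q ≤ (2 ^ (m + 1) * (ε * ε ^ (1 / (m:ℝ)))) ^ q :=
                Real.rpow_le_rpow (by linarith) g2 hq.le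
            _ = _ := by
              rw [Real.mul_rpow (by positivity) (by positivity)]
              congr 1
              rw [mul_comm q, Real.rpow_mul h0.le, Real.rpow_add h0, Real.rpow_one]
        calc ε ^ (-(γ * p)) * (C * (e - ε) ^ q)
            ≤ ε ^ (-(γ * p)) * (C * ((2 ^ (m + 1)) ^ q * ε ^ (q * (1 + 1 / (m:ℝ))))) := by gcongr
          _ = _ := by
            rw [sub_eq_add_neg, Real.rpow_add h0]; ring

lemma close_tendsto {b : ℝ → ℝ} {γ : ℝ} {p m : ℕ} (hm : m ≠ 0) {q C : ℝ} (hC : 0 ≤ C)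
    (hq : 0 < q) (hqq : γ * p < q * (1 + 1 / (m:ℝ)))
    (hw : ∀ h, 0 ≤ h → h ≤ 1 → wmod p b 2 h ≤ ENNReal.ofReal (C * h ^ q)) :
    Tendsto (fun ε => ∫⁻ t in Set.Icc (0:ℝ) 1, ENNReal.ofReal (|zd b γ ε t -
        (eN m (nE m ε + 1) / ε) ^ γ * zd b γ (eN m (nE m ε + 1)) t| ^ p)) (𝓝[>] 0) (𝓝 0) := by
  have hup : Tendsto (fun ε : ℝ => ENNReal.ofReal (C * (2 ^ (m + 1)) ^ q * ε ^ (q * (1 + 1 / (m:ℝ)) - γ * p)))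
      (𝓝[>] 0) (𝓝 0) := by
    have : Tendsto (fun ε : ℝ => C * (2 ^ (m + 1)) ^ q * ε ^ (q * (1 + 1 / (m:ℝ)) - γ * p)) (𝓝 0)
        (𝓝 (C * (2 ^ (m + 1)) ^ q * (0:ℝ) ^ (q * (1 + 1 / (m:ℝ)) - γ * p))) := by
      have hc : ContinuousAt (fun ε : ℝ => ε ^ (q * (1 + 1 / (m:ℝ)) - γ * p)) 0 :=
        Real.continuousAt_rpow_const _ _ (Or.inr (by linarith))
      exact hc.tendsto.const_mul _
    rw [Real.zero_rpow (by linarith), mul_zero] at this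
    simpa using ENNReal.tendsto_ofReal (this.mono_left nhdsWithin_le_nhds)
  refine tendsto_of_tendsto_of_tendsto_of_le_of_le' tendsto_const_nhds hup
    (Eventually.of_forall fun _ => zero_le) ?_
  filter_upwards [Ioc_mem_nhdsGT zero_lt_one] with ε hε
  exact close_bound hm hC hq hw hε.1 hε.2

lemma approx_tendsto {α : Type*} {l : Filter α} {u : α → ℝ} {a : ℝ}
    (h : ∀ δ > 0, ∃ (v : α → ℝ) (c : ℝ), Tendsto v l (𝓝 c) ∧ (∀ᶠ x in l, |u x - v x| ≤ δ) ∧ |c - a| ≤ δ) :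
    Tendsto u l (𝓝 a) := by
  rw [Metric.tendsto_nhds]
  intro δ hδ
  obtain ⟨v, c, h1, h2, h3⟩ := h (δ / 4) (by linarith)
  filter_upwards [h2, Metric.tendsto_nhds.1 h1 (δ / 4) (by linarith)] with x hx hx2
  rw [Real.dist_eq] at *
  calc |u x - a| = |(u x - v x) + (v x - c) + (c - a)| := by congr 1; ring
    _ ≤ |u x - v x| + |v x - c| + |c - a| := abs_add_three _ _ _
    _ < δ := by linarith

lemma abs_int_le {ν : Measure ℝ} (hν : ν ≤ nu01) {g G : ℝ → ℝ} {L M : ℝ} (hL : 0 ≤ L) (hM : 0 ≤ M)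
    (hg : ∀ t, |g t| ≤ L * |G t|)
    (hfin : ∫⁻ t in Set.Icc (0:ℝ) 1, ENNReal.ofReal |G t| ≤ ENNReal.ofReal M) :
    |∫ t, g t ∂ν| ≤ L * M := by
  have h1 : ‖∫ t, g t ∂ν‖ₑ ≤ ENNReal.ofReal (L * M) := by
    calc ‖∫ t, g t ∂ν‖ₑ ≤ ∫⁻ t, ‖g t‖ₑ ∂ν := enorm_integral_le_lintegral_enorm _
      _ ≤ ∫⁻ t, ‖g t‖ₑ ∂nu01 := lintegral_mono' hν le_rfl
      _ ≤ ∫⁻ t, ENNReal.ofReal L * ENNReal.ofReal |G t| ∂nu01 := by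
        refine lintegral_mono fun t => ?_
        rw [Real.enorm_eq_ofReal_abs, ← ENNReal.ofReal_mul hL]
        exact ENNReal.ofReal_le_ofReal (hg t)
      _ = ENNReal.ofReal L * ∫⁻ t, ENNReal.ofReal |G t| ∂nu01 :=
        lintegral_const_mul' _ _ ENNReal.ofReal_ne_top
      _ ≤ ENNReal.ofReal L * ENNReal.ofReal M := by gcongr; exact hfin
      _ = _ := by rw [ENNReal.ofReal_mul hL]
  rw [Real.enorm_eq_ofReal_abs] at h1
  exact (ENNReal.ofReal_le_ofReal_iff (by positivity)).1 h1

lemma ratio_pow_tendsto {m : ℕ} (hm : m ≠ 0) (γ : ℝ) :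
    Tendsto (fun ε => (eN m (nE m ε + 1) / ε) ^ γ) (𝓝[>] 0) (𝓝 1) := by
  have := (ratio_tendsto hm).rpow_const (p := γ) (Or.inl one_ne_zero)
  simpa using this

lemma Lp_bdd {b : ℝ → ℝ} (hb : Measurable b) {γ : ℝ} {p m : ℕ} (hm : m ≠ 0) {M' : ℝ} (hM' : 0 ≤ M')
    (hgrid : ∀ n, ∫⁻ t in Set.Icc (0:ℝ) 1, ENNReal.ofReal (|zd b γ (eN m (n + 1)) t| ^ p) ≤ ENNReal.ofReal M')
    (hclose : Tendsto (fun ε => ∫⁻ t in Set.Icc (0:ℝ) 1, ENNReal.ofReal (|zd b γ ε t -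
        (eN m (nE m ε + 1) / ε) ^ γ * zd b γ (eN m (nE m ε + 1)) t| ^ p)) (𝓝[>] 0) (𝓝 0)) :
    ∃ M : ℝ, 0 ≤ M ∧ ∀ᶠ ε in 𝓝[>] 0,
      ∫⁻ t in Set.Icc (0:ℝ) 1, ENNReal.ofReal (|zd b γ ε t| ^ p) ≤ ENNReal.ofReal M := by
  refine ⟨2 ^ p * (1 + 2 ^ p * M'), by positivity, ?_⟩
  filter_upwards [hclose.eventually (ge_mem_nhds (zero_lt_one)),
    (ratio_pow_tendsto hm γ).eventually (ge_mem_nhds (one_lt_two)), self_mem_nhdsWithin] with ε h1 h2 h0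
  have h0 : 0 < ε := h0
  set e := eN m (nE m ε + 1) with he
  have he0 : 0 < e := eN_pos m _
  have hpt : ∀ t, ENNReal.ofReal (|zd b γ ε t| ^ p) ≤ ENNReal.ofReal (2 ^ p) *
      (ENNReal.ofReal (|zd b γ ε t - (e / ε) ^ γ * zd b γ e t| ^ p) +
        ENNReal.ofReal (2 ^ p) * ENNReal.ofReal (|zd b γ e t| ^ p)) := by
    intro t
    rw [← ENNReal.ofReal_mul (by positivity), ← ENNReal.ofReal_add (by positivity) (by positivity),
      ← ENNReal.ofReal_mul (by positivity)]
    apply ENNReal.ofReal_le_ofReal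
    set x := zd b γ ε t
    set z := zd b γ e t
    set r := (e / ε) ^ γ
    have hr : 0 ≤ r := by positivity
    have e1 : |x| ≤ |x - r * z| + 2 * |z| := by
      calc |x| = |(x - r * z) + r * z| := by congr 1; ring
        _ ≤ |x - r * z| + |r * z| := abs_add_le _ _
        _ ≤ _ := by
          rw [abs_mul, abs_of_nonneg hr]
          gcongr
    calc |x| ^ p ≤ (|x - r * z| + 2 * |z|) ^ p := by gcongr
      _ ≤ 2 ^ (p - 1) * (|x - r * z| ^ p + (2 * |z|) ^ p) := add_pow_le (by positivity) (by positivity) p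
      _ ≤ _ := by
        rw [mul_pow]
        gcongr
        · norm_num
        · omega
  have mz := zd_meas hb γ e
  have mx := zd_meas hb γ ε
  calc _ ≤ ∫⁻ t in Set.Icc (0:ℝ) 1, ENNReal.ofReal (2 ^ p) *
      (ENNReal.ofReal (|zd b γ ε t - (e / ε) ^ γ * zd b γ e t| ^ p) +
        ENNReal.ofReal (2 ^ p) * ENNReal.ofReal (|zd b γ e t| ^ p)) := lintegral_mono hpt
    _ = ENNReal.ofReal (2 ^ p) * ((∫⁻ t in Set.Icc (0:ℝ) 1,
        ENNReal.ofReal (|zd b γ ε t - (e / ε) ^ γ * zd b γ e t| ^ p)) +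
        ENNReal.ofReal (2 ^ p) * ∫⁻ t in Set.Icc (0:ℝ) 1, ENNReal.ofReal (|zd b γ e t| ^ p)) := by
        rw [lintegral_const_mul' _ _ ENNReal.ofReal_ne_top, lintegral_add_left (by fun_prop),
          lintegral_const_mul' _ _ ENNReal.ofReal_ne_top]
    _ ≤ ENNReal.ofReal (2 ^ p) * (1 + ENNReal.ofReal (2 ^ p) * ENNReal.ofReal M') := by
        gcongr
        exact hgrid _
    _ = _ := by
        rw [ENNReal.ofReal_mul (by positivity), ENNReal.ofReal_add zero_le_one (by positivity),
          ENNReal.ofReal_mul (by positivity)]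
        simp

lemma close1 {b : ℝ → ℝ} (hb : Measurable b) {γ : ℝ} {m : ℕ} (hm : m ≠ 0) {M' : ℝ}
    (hgrid : ∀ n, ∫⁻ t in Set.Icc (0:ℝ) 1, ENNReal.ofReal (|zd b γ (eN m (n + 1)) t| ^ 1) ≤ ENNReal.ofReal M')
    (hclose : Tendsto (fun ε => ∫⁻ t in Set.Icc (0:ℝ) 1, ENNReal.ofReal (|zd b γ ε t -
        (eN m (nE m ε + 1) / ε) ^ γ * zd b γ (eN m (nE m ε + 1)) t| ^ 1)) (𝓝[>] 0) (𝓝 0)) :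
    Tendsto (fun ε => ∫⁻ t in Set.Icc (0:ℝ) 1, ENNReal.ofReal |zd b γ ε t - zd b γ (eN m (nE m ε + 1)) t|)
      (𝓝[>] 0) (𝓝 0) := by
  have hup : Tendsto (fun ε => (∫⁻ t in Set.Icc (0:ℝ) 1, ENNReal.ofReal (|zd b γ ε t -
        (eN m (nE m ε + 1) / ε) ^ γ * zd b γ (eN m (nE m ε + 1)) t| ^ 1)) +
        ENNReal.ofReal |(eN m (nE m ε + 1) / ε) ^ γ - 1| * ENNReal.ofReal M') (𝓝[>] 0) (𝓝 0) := by
    have h1 : Tendsto (fun ε => ENNReal.ofReal |(eN m (nE m ε + 1) / ε) ^ γ - 1|) (𝓝[>] 0) (𝓝 0) := by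
      have := ENNReal.tendsto_ofReal ((ratio_pow_tendsto hm γ).sub_const 1).abs
      simpa using this
    have h2 := ENNReal.Tendsto.mul_const h1 (Or.inr (ENNReal.ofReal_ne_top (r := M')))
    simpa using hclose.add h2
  refine tendsto_of_tendsto_of_tendsto_of_le_of_le tendsto_const_nhds hup
    (fun _ => zero_le) fun ε => ?_
  set e := eN m (nE m ε + 1) with he
  set r := (e / ε) ^ γ
  have mz := zd_meas hb γ e
  have mx := zd_meas hb γ ε
  calc ∫⁻ t in Set.Icc (0:ℝ) 1, ENNReal.ofReal |zd b γ ε t - zd b γ e t|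
      ≤ ∫⁻ t in Set.Icc (0:ℝ) 1, (ENNReal.ofReal (|zd b γ ε t - r * zd b γ e t| ^ 1) +
        ENNReal.ofReal |r - 1| * ENNReal.ofReal (|zd b γ e t| ^ 1)) := by
        refine lintegral_mono fun t => ?_
        simp only
        rw [← ENNReal.ofReal_mul (by positivity), ← ENNReal.ofReal_add (by positivity) (by positivity)]
        apply ENNReal.ofReal_le_ofReal
        rw [pow_one, pow_one, ← abs_mul]
        refine le_trans (le_of_eq ?_) (abs_add_le _ _)
        congr 1; ring
    _ = (∫⁻ t in Set.Icc (0:ℝ) 1, ENNReal.ofReal (|zd b γ ε t - r * zd b γ e t| ^ 1)) +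
        ENNReal.ofReal |r - 1| * ∫⁻ t in Set.Icc (0:ℝ) 1, ENNReal.ofReal (|zd b γ e t| ^ 1) := by
        rw [lintegral_add_left (by fun_prop), lintegral_const_mul' _ _ ENNReal.ofReal_ne_top]
    _ ≤ _ := by
        gcongr
        exact hgrid _

lemma lip_tendsto {b : ℝ → ℝ} (hb : Measurable b) {γ : ℝ} {m : ℕ} (hm : m ≠ 0)
    {ν : Measure ℝ} (hν : ν ≤ nu01)
    (hc : Tendsto (fun ε => ∫⁻ t in Set.Icc (0:ℝ) 1,
      ENNReal.ofReal |zd b γ ε t - zd b γ (eN m (nE m ε + 1)) t|) (𝓝[>] 0) (𝓝 0))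
    {φ : ℝ → ℝ} (hφc : Continuous φ) (hφb : ∀ x, |φ x| ≤ 1) {L : ℝ} (hL : 0 < L)
    (hφ : ∀ x y, |φ x - φ y| ≤ L * |x - y|) {ℓ : ℝ}
    (hlim : Tendsto (fun n => ∫ t, φ (zd b γ (eN m (n + 1)) t) ∂ν) atTop (𝓝 ℓ)) :
    Tendsto (fun ε => ∫ t, φ (zd b γ ε t) ∂ν) (𝓝[>] 0) (𝓝 ℓ) := by
  have : IsFiniteMeasure ν := isFiniteMeasure_of_le nu01 hν
  have hi : ∀ ε, Integrable (fun t => φ (zd b γ ε t)) ν := fun ε =>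
    Integrable.of_bound (C := 1) (hφc.measurable.comp (zd_meas hb γ ε)).aestronglyMeasurable
      (Eventually.of_forall fun t => hφb _)
  refine approx_tendsto fun δ hδ => ⟨fun ε => ∫ t, φ (zd b γ (eN m (nE m ε + 1)) t) ∂ν, ℓ,
    hlim.comp (nE_tendsto hm), ?_, by simpa using hδ.le⟩
  have hpos : (0:ENNReal) < ENNReal.ofReal (δ / L) := by rw [ENNReal.ofReal_pos]; positivity
  filter_upwards [hc.eventually (ge_mem_nhds hpos)] with ε hε
  rw [← integral_sub (hi _) (hi _)]
  refine (abs_int_le hν hL.le (by positivity) (fun t => hφ _ _) hε).trans (le_of_eq ?_)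
  field_simp

lemma all_theta {b : ℝ → ℝ} (hb : Measurable b) {γ : ℝ} {ν : Measure ℝ} (hν : ν ≤ nu01) {M : ℝ} (hM : 0 ≤ M)
    (hbd : ∀ᶠ ε in 𝓝[>] 0, ∫⁻ t in Set.Icc (0:ℝ) 1, ENNReal.ofReal (|zd b γ ε t| ^ 1) ≤ ENNReal.ofReal M)
    {φ : ℝ → ℝ} (hφc : Continuous φ) (hφb : ∀ x, |φ x| ≤ 1)
    (hφ : ∀ x y, |φ x - φ y| ≤ |x - y|) {F : ℝ → ℝ} (hF : Continuous F)
    (hlim : ∀ q : ℚ, Tendsto (fun ε => ∫ t, φ (q * zd b γ ε t) ∂ν) (𝓝[>] 0) (𝓝 (F q))) (θ : ℝ) :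
    Tendsto (fun ε => ∫ t, φ (θ * zd b γ ε t) ∂ν) (𝓝[>] 0) (𝓝 (F θ)) := by
  have : IsFiniteMeasure ν := isFiniteMeasure_of_le nu01 hν
  have hi : ∀ θ ε, Integrable (fun t => φ (θ * zd b γ ε t)) ν := fun θ ε =>
    Integrable.of_bound (C := 1)
      (hφc.measurable.comp ((zd_meas hb γ ε).const_mul θ)).aestronglyMeasurable
      (Eventually.of_forall fun t => hφb _)
  refine approx_tendsto fun δ hδ => ?_
  have hopen : IsOpen {x : ℝ | |θ - x| * M < δ ∧ |F x - F θ| < δ} := by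
    have h1 : IsOpen {x : ℝ | |θ - x| * M < δ} := isOpen_lt (by fun_prop) continuous_const
    have h2 : IsOpen {x : ℝ | |F x - F θ| < δ} := isOpen_lt (by fun_prop) continuous_const
    exact h1.inter h2
  obtain ⟨q, hq⟩ := Rat.denseRange_cast.exists_mem_open hopen ⟨θ, by simpa using hδ⟩
  refine ⟨_, _, hlim q, ?_, hq.2.le⟩
  filter_upwards [hbd] with ε hε
  rw [← integral_sub (hi _ _) (hi _ _)]
  simp only [pow_one] at hε
  refine (abs_int_le hν (abs_nonneg (θ - q)) hM (fun t => ?_) hε).trans hq.1.le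
  refine (hφ _ _).trans (le_of_eq ?_)
  rw [← abs_mul]; congr 1; ring

lemma weak_conv {ν : Measure ℝ} [IsFiniteMeasure ν] [NeZero ν] {X : ℕ → ℝ → ℝ} (hX : ∀ n, Measurable (X n))
    {v : NNReal}
    (hcos : ∀ θ : ℝ, Tendsto (fun n => ∫ t, Real.cos (θ * X n t) ∂ν) atTop
      (𝓝 (ν.real Set.univ * Real.exp (-(θ ^ 2 * v / 2)))))
    (hsin : ∀ θ : ℝ, Tendsto (fun n => ∫ t, Real.sin (θ * X n t) ∂ν) atTop (𝓝 0)) :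
    (∀ f : BoundedContinuousFunction ℝ ℝ, Tendsto (fun n => ∫ t, f (X n t) ∂ν) atTop
      (𝓝 (ν.real Set.univ * ∫ x, f x ∂(gaussianReal 0 v)))) ∧
    (v ≠ 0 → ∀ x : ℝ, Tendsto (fun n => (ν {t | X n t ≤ x}).toReal) atTop
      (𝓝 (ν.real Set.univ * (gaussianReal 0 v (Set.Iic x)).toReal))) := by
  set w : ℝ := ν.real Set.univ with hw
  have hw0 : 0 < w := by
    rw [hw, Measure.real]
    exact ENNReal.toReal_pos (NeZero.ne _) (measure_ne_top _ _)
  set P : Measure ℝ := (ν Set.univ)⁻¹ • ν with hP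
  have hPp : IsProbabilityMeasure P := inferInstance
  have hwi : ((ν Set.univ)⁻¹).toReal = w⁻¹ := by
    rw [ENNReal.toReal_inv]; rfl
  have hPint : ∀ {E : Type} [NormedAddCommGroup E] [NormedSpace ℝ E] (g : ℝ → E), ∫ t, g t ∂P = w⁻¹ • ∫ t, g t ∂ν := by
    intro E _ _ g
    rw [hP, integral_smul_measure, hwi]
  let Q : ℕ → ProbabilityMeasure ℝ := fun n =>
    ⟨P.map (X n), Measure.isProbabilityMeasure_map (hX n).aemeasurable⟩
  let Q0 : ProbabilityMeasure ℝ := ⟨gaussianReal 0 v, inferInstance⟩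
  have hQ : Tendsto Q atTop (𝓝 Q0) := by
    refine ProbabilityMeasure.tendsto_of_tendsto_charFun fun θ => ?_
    have hlim : charFun (Q0 : Measure ℝ) θ = ((Real.exp (-(θ ^ 2 * v / 2)) : ℝ) : ℂ) := by
      change charFun (gaussianReal 0 v) θ = _
      rw [charFun_gaussianReal]
      push_cast
      congr 1
      simp
      ring
    have hseq : ∀ n, charFun (Q n : Measure ℝ) θ =
        ((w⁻¹ * ∫ t, Real.cos (θ * X n t) ∂ν : ℝ) : ℂ) + ((w⁻¹ * ∫ t, Real.sin (θ * X n t) ∂ν : ℝ) : ℂ) * Complex.I := by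
      intro n
      change charFun (P.map (X n)) θ = _
      have m1 : Measurable (fun t => θ * X n t) := (hX n).const_mul θ
      have i1 : Integrable (fun t => Real.cos (θ * X n t)) ν :=
        Integrable.of_bound (C := 1) (Real.continuous_cos.measurable.comp m1).aestronglyMeasurable
          (Eventually.of_forall fun t => Real.abs_cos_le_one _)
      have i2 : Integrable (fun t => Real.sin (θ * X n t)) ν :=
        Integrable.of_bound (C := 1) (Real.continuous_sin.measurable.comp m1).aestronglyMeasurable
          (Eventually.of_forall fun t => Real.abs_sin_le_one _)
      rw [charFun_apply_real, integral_map (hX n).aemeasurable (by fun_prop), hPint]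
      have e : ∀ t, Complex.exp (θ * (X n t : ℂ) * Complex.I) =
          ((Real.cos (θ * X n t) : ℝ) : ℂ) + ((Real.sin (θ * X n t) : ℝ) : ℂ) * Complex.I := by
        intro t
        rw [Complex.exp_mul_I]; push_cast; rfl
      simp_rw [e]
      rw [integral_add i1.ofReal (i2.ofReal.mul_const _), integral_mul_const, integral_complex_ofReal, integral_complex_ofReal,
        Complex.real_smul]
      push_cast
      ring
    simp_rw [hseq]
    rw [hlim]
    have h1 := (hcos θ).const_mul w⁻¹
    have h2 := (hsin θ).const_mul w⁻¹
    rw [← mul_assoc, inv_mul_cancel₀ hw0.ne', one_mul] at h1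
    rw [mul_zero] at h2
    have h3 := ((Complex.continuous_ofReal.tendsto _).comp h1).add
      (((Complex.continuous_ofReal.tendsto _).comp h2).mul_const Complex.I)
    simpa using h3
  constructor
  · intro f
    have h1 := (ProbabilityMeasure.tendsto_iff_forall_integral_tendsto.1 hQ f).const_mul w
    refine h1.congr fun n => ?_
    change w * ∫ x, f x ∂(P.map (X n)) = _
    rw [integral_map (hX n).aemeasurable f.continuous.aestronglyMeasurable, hPint, smul_eq_mul,
      ← mul_assoc, mul_inv_cancel₀ hw0.ne', one_mul]
  · intro hv x
    have : NullSingletonClass (gaussianReal 0 v) := nullSingletonClass_gaussianReal hv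
    have h1 := ProbabilityMeasure.tendsto_measure_of_null_frontier_of_tendsto' hQ (E := Set.Iic x) (by
      rw [frontier_Iic]
      change gaussianReal 0 v {x} = 0
      exact measure_singleton x)
    have h2 := ((ENNReal.tendsto_toReal (measure_ne_top _ _)).comp h1).const_mul w
    refine h2.congr fun n => ?_
    change w * ((P.map (X n)) (Set.Iic x)).toReal = _
    rw [Measure.map_apply (hX n) measurableSet_Iic, hP, Measure.smul_apply, smul_eq_mul, ENNReal.toReal_mul, hwi,
      ← mul_assoc, mul_inv_cancel₀ hw0.ne', one_mul]
    rfl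

/-- truncation of a real number -/
noncomputable def clampR (M x : ℝ) : ℝ := max (-M) (min x M)

lemma clampR_abs {M : ℝ} (hM : 0 ≤ M) (x : ℝ) : |clampR M x| ≤ M := by
  unfold clampR
  rw [abs_le]
  exact ⟨le_max_left _ _, max_le (by linarith) (min_le_right _ _)⟩

lemma clampR_err {M : ℝ} (hM : 0 < M) (k : ℕ) (x : ℝ) :
    |x ^ k - clampR M x ^ k| ≤ 2 / M ^ k * |x ^ (2 * k)| := by
  by_cases hx : |x| ≤ M
  · have : clampR M x = x := by
      unfold clampR
      rw [abs_le] at hx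
      rw [min_eq_left hx.2, max_eq_right hx.1]
    rw [this, sub_self, abs_zero]
    positivity
  · push Not at hx
    have h1 := clampR_abs hM.le x
    calc |x ^ k - clampR M x ^ k| ≤ |x ^ k| + |clampR M x ^ k| := abs_sub _ _
      _ ≤ |x| ^ k + |x| ^ k := by
        rw [abs_pow, abs_pow]
        exact add_le_add le_rfl (pow_le_pow_left₀ (abs_nonneg _) (by linarith) k)
      _ = 2 / M ^ k * (M ^ k * |x| ^ k) := by field_simp; ring
      _ ≤ 2 / M ^ k * (|x| ^ k * |x| ^ k) := by gcongr
      _ = _ := by rw [abs_pow, ← pow_add, two_mul]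

lemma gauss_pow_int (v : NNReal) (k : ℕ) : Integrable (fun x : ℝ => x ^ k) (gaussianReal 0 v) := by
  rcases Nat.eq_zero_or_pos k with rfl | hk
  · simp
  have h := memLp_id_gaussianReal (μ := 0) (v := v) (k : NNReal)
  have h2 := h.integrable_norm_pow (by omega)
  refine h2.mono (by fun_prop) (Eventually.of_forall fun x => ?_)
  simp

lemma moment_conv {b : ℝ → ℝ} (hb : Measurable b) {γ : ℝ} {k : ℕ} (hk : k ≠ 0) {v : NNReal} {M : ℝ} (hM : 0 ≤ M)
    (hbd : ∀ᶠ ε in 𝓝[>] 0, ∫⁻ t in Set.Icc (0:ℝ) 1, ENNReal.ofReal (|zd b γ ε t| ^ (2 * k)) ≤ ENNReal.ofReal M)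
    (hweak : ∀ f : BoundedContinuousFunction ℝ ℝ, Tendsto (fun ε => ∫ t, f (zd b γ ε t) ∂nu01) (𝓝[>] 0)
      (𝓝 (∫ x, f x ∂(gaussianReal 0 v)))) :
    Tendsto (fun ε => ∫ t, zd b γ ε t ^ k ∂nu01) (𝓝[>] 0) (𝓝 (∫ x, x ^ k ∂(gaussianReal 0 v))) := by
  refine approx_tendsto fun δ hδ => ?_
  set M2 : ℝ := M + ∫ x, |x ^ (2 * k)| ∂(gaussianReal 0 v) with hM2
  have hg0 : 0 ≤ ∫ x, |x ^ (2 * k)| ∂(gaussianReal 0 v) := integral_nonneg fun _ => abs_nonneg _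
  have hM20 : 0 ≤ M2 := by positivity
  obtain ⟨A, hA1, hA⟩ : ∃ A : ℝ, 1 ≤ A ∧ 2 / A ^ k * M2 ≤ δ := by
    refine ⟨max 1 (2 * M2 / δ), le_max_left _ _, ?_⟩
    set A := max 1 (2 * M2 / δ)
    have h1 : 1 ≤ A := le_max_left _ _
    have h2 : 2 * M2 / δ ≤ A ^ k := (le_max_right _ _).trans (le_self_pow₀ h1 hk)
    have h3 : 0 < A ^ k := by positivity
    rw [div_le_iff₀ hδ] at h2
    rw [div_mul_eq_mul_div, div_le_iff₀ h3]
    linarith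
  have hA0 : 0 < A := by linarith
  have hcc : Continuous (fun x => clampR A x ^ k) := by unfold clampR; fun_prop
  let f : BoundedContinuousFunction ℝ ℝ := BoundedContinuousFunction.ofNormedAddCommGroup
    (fun x => clampR A x ^ k) hcc (A ^ k) (fun x => by
      rw [Real.norm_eq_abs, abs_pow]
      have := clampR_abs hA0.le x
      gcongr)
  refine ⟨_, _, hweak f, ?_, ?_⟩
  · filter_upwards [hbd] with ε hε
    have mz := zd_meas hb γ ε
    have hfin : ∫⁻ t in Set.Icc (0:ℝ) 1, ENNReal.ofReal |zd b γ ε t ^ (2 * k)| ≤ ENNReal.ofReal M := by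
      simpa only [abs_pow] using hε
    have i2 : Integrable (fun t => zd b γ ε t ^ (2 * k)) nu01 := by
      refine ⟨by fun_prop, ?_⟩
      rw [hasFiniteIntegral_iff_norm]
      exact lt_of_le_of_lt hfin ENNReal.ofReal_lt_top
    have i1 : Integrable (fun t => zd b γ ε t ^ k) nu01 := by
      refine ((integrable_const (1:ℝ)).add i2).mono (by fun_prop) (Eventually.of_forall fun t => ?_)
      simp only [Pi.add_apply]
      rw [Real.norm_eq_abs, Real.norm_eq_abs, pow_mul', abs_of_nonneg (a := 1 + _) (by positivity)]
      rw [abs_le]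
      constructor <;> nlinarith [sq_nonneg (zd b γ ε t ^ k - 1), sq_nonneg (zd b γ ε t ^ k + 1)]
    have i3 : Integrable (fun t => f (zd b γ ε t)) nu01 :=
      Integrable.of_bound (C := ‖f‖) (f.continuous.measurable.comp mz).aestronglyMeasurable
        (Eventually.of_forall fun t => f.norm_coe_le_norm _)
    rw [← integral_sub i1 i3]
    refine (abs_int_le le_rfl (by positivity : 0 ≤ 2 / A ^ k) hM
      (fun t => clampR_err hA0 k (zd b γ ε t)) hfin).trans (le_trans ?_ hA)
    gcongr
    linarith
  · have i3 : Integrable (fun x => f x) (gaussianReal 0 v) := f.integrable _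
    rw [← integral_sub i3 (gauss_pow_int v k)]
    refine (abs_integral_le_integral_abs).trans ?_
    calc ∫ x, |f x - x ^ k| ∂(gaussianReal 0 v) ≤ ∫ x, 2 / A ^ k * |x ^ (2 * k)| ∂(gaussianReal 0 v) := by
          refine integral_mono (i3.sub (gauss_pow_int v k)).abs ((gauss_pow_int v _).abs.const_mul _) fun x => ?_
          simp only
          rw [abs_sub_comm]
          exact clampR_err hA0 k x
      _ = 2 / A ^ k * ∫ x, |x ^ (2 * k)| ∂(gaussianReal 0 v) := integral_const_mul _ _
      _ ≤ 2 / A ^ k * M2 := by gcongr; linarith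
      _ ≤ δ := hA

section final
variable {Ω : Type*} [MeasurableSpace Ω] {μ : Measure Ω} {H K : ℝ} {B : ℝ → Ω → ℝ}

lemma path_facts [IsProbabilityMeasure μ] (hH : 0 < H) (hH1 : H < 1) (hK : 0 < K) (hK1 : K ≤ 1)
    (hB : IsBifBM μ H K B) (hmeas : Measurable (fun p : ℝ × Ω => B p.1 p.2)) {m : ℕ} (hm0 : m ≠ 0)
    (hm : 2 ≤ m * min 1 (2 - 2 * H * K)) {p : ℕ} (hp : p ≠ 0) :
    ∀ᵐ ω ∂μ, (∃ M' : ℝ, 0 ≤ M' ∧ ∀ n, ∫⁻ t in Set.Icc (0:ℝ) 1,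
      ENNReal.ofReal (|zd (fun t => B t ω) (H * K) (eN m (n + 1)) t| ^ p) ≤ ENNReal.ofReal M') ∧
      Tendsto (fun ε => ∫⁻ t in Set.Icc (0:ℝ) 1, ENNReal.ofReal (|zd (fun t => B t ω) (H * K) ε t -
        (eN m (nE m ε + 1) / ε) ^ (H * K) * zd (fun t => B t ω) (H * K) (eN m (nE m ε + 1)) t| ^ p))
        (𝓝[>] 0) (𝓝 0) := by
  have hm' : (0:ℝ) < m := by positivity
  have hp' : (0:ℝ) < p := by positivity
  have hγ : 0 < H * K := by positivity
  set q : ℝ := H * K * p * ((m + 1 / 2) / (m + 1)) with hq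
  have hq0 : 0 < q := by positivity
  have hq1 : q < H * K * p := by
    have : ((m:ℝ) + 1 / 2) / (m + 1) < 1 := by
      rw [div_lt_one (by linarith)]; linarith
    have h2 : 0 < H * K * p := by positivity
    calc q < H * K * p * 1 := by rw [hq]; gcongr
      _ = _ := mul_one _
  have hq2 : H * K * p < q * (1 + 1 / (m:ℝ)) := by
    have : q * (1 + 1 / (m:ℝ)) = H * K * p * ((m + 1 / 2) / m) := by
      rw [hq]; field_simp
    rw [this]
    have h3 : 1 < ((m:ℝ) + 1 / 2) / m := by
      rw [one_lt_div hm']; linarith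
    have h2 : 0 < H * K * p := by positivity
    calc H * K * p = H * K * p * 1 := (mul_one _).symm
      _ < _ := by gcongr
  filter_upwards [modulus hH hK hK1 hB hmeas hp hq0 hq1,
    grid_conv hH hH1 hK hK1 hB hmeas hm0 hm good_cosh (le_refl nu01)] with ω h1 h2
  obtain ⟨C, hC, hw⟩ := h1
  obtain ⟨hIntg, hconv⟩ := h2
  refine ⟨?_, close_tendsto hm0 hC hq0 hq2 hw⟩
  obtain ⟨M0, hM0⟩ := hconv.bddAbove_range
  refine ⟨(p.factorial : ℝ) * 2 * |M0|, by positivity, fun n => ?_⟩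
  have h3 : ∫ t, Real.cosh (ZZ B (H * K) (eN m (n + 1)) t ω) ∂nu01 ≤ |M0| :=
    (hM0 ⟨n, rfl⟩).trans (le_abs_self _)
  calc _ ≤ ∫⁻ t, ENNReal.ofReal ((p.factorial : ℝ) * 2 * Real.cosh (ZZ B (H * K) (eN m (n + 1)) t ω)) ∂nu01 :=
        lintegral_mono fun t => ENNReal.ofReal_le_ofReal (pow_le_cosh p _)
    _ = ENNReal.ofReal (∫ t, (p.factorial : ℝ) * 2 * Real.cosh (ZZ B (H * K) (eN m (n + 1)) t ω) ∂nu01) := by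
        rw [ofReal_integral_eq_lintegral_ofReal ((hIntg n).const_mul _)]
        exact Filter.Eventually.of_forall fun t => by
          have := Real.cosh_pos (ZZ B (H * K) (eN m (n + 1)) t ω)
          simp only [Pi.zero_apply]; positivity
    _ ≤ _ := by
        rw [integral_const_mul]
        apply ENNReal.ofReal_le_ofReal
        gcongr

lemma trig_conv [IsProbabilityMeasure μ] (hH : 0 < H) (hH1 : H < 1) (hK : 0 < K) (hK1 : K ≤ 1)
    (hB : IsBifBM μ H K B) (hmeas : Measurable (fun p : ℝ × Ω => B p.1 p.2)) {m : ℕ} (hm0 : m ≠ 0)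
    (hm : 2 ≤ m * min 1 (2 - 2 * H * K)) {ν : Measure ℝ} (hν : ν ≤ nu01) :
    ∀ᵐ ω ∂μ, ∀ θ : ℝ, Tendsto (fun ε => ∫ t, Real.cos (θ * zd (fun t => B t ω) (H * K) ε t) ∂ν) (𝓝[>] 0)
        (𝓝 (ν.real Set.univ * Real.exp (-(θ ^ 2 * (2:ℝ) ^ (1 - K) / 2)))) ∧
      Tendsto (fun ε => ∫ t, Real.sin (θ * zd (fun t => B t ω) (H * K) ε t) ∂ν) (𝓝[>] 0) (𝓝 0) := by
  have hcos := ae_all_iff.2 fun q : ℚ => grid_conv hH hH1 hK hK1 hB hmeas hm0 hm (good_cos (q : ℝ)) hν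
  have hsin := ae_all_iff.2 fun q : ℚ => grid_conv hH hH1 hK hK1 hB hmeas hm0 hm (good_sin (q : ℝ)) hν
  filter_upwards [path_facts hH hH1 hK hK1 hB hmeas hm0 hm one_ne_zero, hcos, hsin] with ω hf hc hs
  obtain ⟨⟨M', hM', hgrid⟩, hclose⟩ := hf
  have hb : Measurable (fun t => B t ω) := hmeas.comp (f := fun t : ℝ => (t, ω)) (by fun_prop)
  have hc1 := close1 hb hm0 hgrid hclose
  obtain ⟨M, hM, hbd⟩ := Lp_bdd hb hm0 hM' hgrid hclose
  have hlip : ∀ (φ : ℝ → ℝ), (∀ x y, |φ x - φ y| ≤ |x - y|) → ∀ q x y : ℝ,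
      |φ (q * x) - φ (q * y)| ≤ (|q| + 1) * |x - y| := by
    intro φ hφ q x y
    refine (hφ _ _).trans ?_
    rw [← mul_sub, abs_mul]
    gcongr
    linarith
  intro θ
  constructor
  · refine all_theta hb hν hM hbd Real.continuous_cos Real.abs_cos_le_one Real.abs_cos_sub_cos_le
      (F := fun θ => ν.real Set.univ * Real.exp (-(θ ^ 2 * (2:ℝ) ^ (1 - K) / 2))) (by fun_prop) (fun q => ?_) θ
    exact lip_tendsto hb hm0 hν hc1 (φ := fun x => Real.cos (q * x)) (by fun_prop) (fun x => Real.abs_cos_le_one _)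
      (L := |(q:ℝ)| + 1) (by positivity) (hlip _ Real.abs_cos_sub_cos_le q) (hc q).2
  · refine all_theta hb hν hM hbd Real.continuous_sin Real.abs_sin_le_one Real.abs_sin_sub_sin_le
      (F := fun θ => 0) (by fun_prop) (fun q => ?_) θ
    have h0 := (hs q).2
    rw [mul_zero] at h0
    exact lip_tendsto hb hm0 hν hc1 (φ := fun x => Real.sin (q * x)) (by fun_prop) (fun x => Real.abs_sin_le_one _)
      (L := |(q:ℝ)| + 1) (by positivity) (hlip _ Real.abs_sin_sub_sin_le q) h0

lemma exists_m (hH : 0 < H) (hH1 : H < 1) (_hK : 0 < K) (hK1 : K ≤ 1) :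
    ∃ m : ℕ, m ≠ 0 ∧ 2 ≤ m * min 1 (2 - 2 * H * K) := by
  have h1 : H * K < 1 := by nlinarith
  have h2 : 0 < min 1 (2 - 2 * H * K) := lt_min one_pos (by nlinarith)
  obtain ⟨m, hm⟩ := exists_nat_ge (2 / min 1 (2 - 2 * H * K))
  refine ⟨m, ?_, (div_le_iff₀ h2).1 hm⟩
  rintro rfl
  have : 0 < 2 / min 1 (2 - 2 * H * K) := by positivity
  simp only [Nat.cast_zero] at hm
  linarith

end final

/-- Proposition 4.6, oscillations of bifractional Brownian motion:
with `Z_ε(t) = (B^{H,K}(t+ε) - B^{H,K}(t))/ε^{HK}` and `ρ` a centered normal random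
variable of variance `σ² = 2^{1-K}`:
(i) for every integer `k ≥ 1`, almost surely `∫₀¹ Z_ε(t)^k dt → E(ρ^k)` as `ε → 0⁺`;
(ii) for every interval `J = [a,b] ⊆ [0,1]`, almost surely, for every `x ∈ ℝ`,
`λ₁{t ∈ J : Z_ε(t) ≤ x} → λ₁(J) P(ρ ≤ x)` as `ε → 0⁺`. -/
theorem bifBM_oscillation {Ω : Type*} [MeasurableSpace Ω]
    (μ : Measure Ω) [IsProbabilityMeasure μ] (H K : ℝ)
    (hH : H ∈ Set.Ioo (0:ℝ) 1) (hK : K ∈ Set.Ioc (0:ℝ) 1)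
    (B : ℝ → Ω → ℝ) (hB : IsBifBM μ H K B)
    (hmeas : Measurable (fun p : ℝ × Ω => B p.1 p.2)) :
    (∀ k : ℕ, 1 ≤ k → ∀ᵐ ω ∂μ,
      Tendsto
        (fun ε : ℝ =>
          ∫ t in Set.Icc (0:ℝ) 1, ((B (t + ε) ω - B t ω) / ε ^ (H * K)) ^ k)
        (𝓝[>] 0)
        (𝓝 (∫ x, x ^ k ∂(gaussianReal 0 (Real.toNNReal ((2:ℝ) ^ (1 - K))))))) ∧
    (∀ a b : ℝ, 0 ≤ a → a ≤ b → b ≤ 1 → ∀ᵐ ω ∂μ, ∀ x : ℝ,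
      Tendsto
        (fun ε : ℝ =>
          (volume {t : ℝ | t ∈ Set.Icc a b ∧
            (B (t + ε) ω - B t ω) / ε ^ (H * K) ≤ x}).toReal)
        (𝓝[>] 0)
        (𝓝 ((b - a) *
          ((gaussianReal 0 (Real.toNNReal ((2:ℝ) ^ (1 - K)))) (Set.Iic x)).toReal))) := by
  obtain ⟨m, hm0, hm⟩ := exists_m hH.1 hH.2 hK.1 hK.2
  have hv0 : (0:ℝ) < (2:ℝ) ^ (1 - K) := by positivity
  have hvv : ((Real.toNNReal ((2:ℝ) ^ (1 - K)) : NNReal) : ℝ) = (2:ℝ) ^ (1 - K) := Real.coe_toNNReal _ hv0.le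
  have hvne : Real.toNNReal ((2:ℝ) ^ (1 - K)) ≠ 0 := by
    rw [Ne, Real.toNNReal_eq_zero]; linarith
  constructor
  · intro k hk
    have hk0 : k ≠ 0 := by omega
    filter_upwards [trig_conv hH.1 hH.2 hK.1 hK.2 hB hmeas hm0 hm (le_refl nu01),
      path_facts hH.1 hH.2 hK.1 hK.2 hB hmeas hm0 hm (p := 2 * k) (by omega)] with ω ht hf
    obtain ⟨⟨M', hM', hgrid⟩, hclose⟩ := hf
    have hb : Measurable (fun t => B t ω) := hmeas.comp (f := fun t : ℝ => (t, ω)) (by fun_prop)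
    obtain ⟨M, hM, hbd⟩ := Lp_bdd hb hm0 hM' hgrid hclose
    refine moment_conv hb hk0 hM hbd fun f => ?_
    rw [tendsto_iff_seq_tendsto]
    intro x hx
    have h := (weak_conv (ν := nu01) (X := fun n => zd (fun t => B t ω) (H * K) (x n))
      (v := Real.toNNReal ((2:ℝ) ^ (1 - K))) (fun n => zd_meas hb _ _)
      (fun θ => by rw [hvv]; exact (ht θ).1.comp hx) (fun θ => (ht θ).2.comp hx)).1 f
    rw [probReal_univ, one_mul] at h
    exact h
  · intro a b ha hab hb1
    rcases hab.eq_or_lt with rfl | hab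
    · refine Eventually.of_forall fun ω x => ?_
      rw [sub_self, zero_mul]
      refine tendsto_const_nhds.congr fun ε => ?_
      have : volume {t : ℝ | t ∈ Set.Icc a a ∧ (B (t + ε) ω - B t ω) / ε ^ (H * K) ≤ x} = 0 := by
        refine measure_mono_null (t := {a}) ?_ (measure_singleton a)
        rintro t ⟨ht, _⟩
        simpa using ht
      rw [this]; rfl
    · set ν : Measure ℝ := volume.restrict (Set.Icc a b) with hνd
      have hν : ν ≤ nu01 := Measure.restrict_mono (Set.Icc_subset_Icc ha hb1) le_rfl
      have hfin : IsFiniteMeasure ν := isFiniteMeasure_of_le nu01 hν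
      have hreal : ν.real Set.univ = b - a := by
        rw [hνd, Measure.real, Measure.restrict_apply_univ, Real.volume_Icc, ENNReal.toReal_ofReal (by linarith)]
      have hne : NeZero ν := ⟨by
        intro h
        rw [h] at hreal
        simp at hreal
        linarith⟩
      filter_upwards [trig_conv hH.1 hH.2 hK.1 hK.2 hB hmeas hm0 hm hν] with ω ht x
      have hbm : Measurable (fun t => B t ω) := hmeas.comp (f := fun t : ℝ => (t, ω)) (by fun_prop)
      rw [tendsto_iff_seq_tendsto]
      intro y hy
      have h := (weak_conv (ν := ν) (X := fun n => zd (fun t => B t ω) (H * K) (y n))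
        (v := Real.toNNReal ((2:ℝ) ^ (1 - K))) (fun n => zd_meas hbm _ _)
        (fun θ => by rw [hvv]; exact (ht θ).1.comp hy) (fun θ => (ht θ).2.comp hy)).2 hvne x
      rw [hreal] at h
      refine h.congr fun n => ?_
      simp only [Function.comp]
      rw [hνd, Measure.restrict_apply (measurableSet_le (zd_meas hbm _ _) measurable_const)]
      congr 2
      ext t
      exact and_comm
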